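/- Let n ≥ 2, let A = Mat_{n×n}(ℂ), and let r(v;y₁,y₂) be a non-degenerate unitary solution of the AYBE, holomorphic on {(v,y₁,y₂) : v ≠ 0, y₁ ≠ y₂}, of the form (*), and meromorphic along the diagonal. Then r̄₀(y₁,y₂) = (pr⊗pr)(r₀(y₁,y₂)) is a non-degenerate unitary solution of the classical Yang–Baxter equation (CYBE), where non-degenerate means that for all (y₁,y₂) in a dense subset of {y₁ ≠ y₂} the tensor r̄₀(y₁,y₂) ∈ sl_n(ℂ)⊗sl_n(ℂ) is invertible as an endomorphism of sl_n(ℂ) under the trace pairing ⟨x,y⟩ = tr(xy). -/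

import Mathlib

open Matrix Kronecker Filter Topology Set

noncomputable section

attribute [local instance] Matrix.normedAddCommGroup Matrix.normedSpace

abbrev Mat (n : ℕ) : Type := Matrix (Fin n) (Fin n) ℂ
abbrev T2 (n : ℕ) : Type := Matrix (Fin n × Fin n) (Fin n × Fin n) ℂ
abbrev T3 (n : ℕ) : Type := Matrix (Fin n × Fin n × Fin n) (Fin n × Fin n × Fin n) ℂ

/-- The embedding `t ↦ t^{12}` of `A ⊗ A` into `A ⊗ A ⊗ A`. -/
def emb12 {n : ℕ} (t : T2 n) : T3 n :=
  Matrix.of fun p q => t (p.1, p.2.1) (q.1, q.2.1) * (if p.2.2 = q.2.2 then 1 else 0)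

/-- The embedding `t ↦ t^{13}` of `A ⊗ A` into `A ⊗ A ⊗ A`. -/
def emb13 {n : ℕ} (t : T2 n) : T3 n :=
  Matrix.of fun p q => t (p.1, p.2.2) (q.1, q.2.2) * (if p.2.1 = q.2.1 then 1 else 0)

/-- The embedding `t ↦ t^{23}` of `A ⊗ A` into `A ⊗ A ⊗ A`. -/
def emb23 {n : ℕ} (t : T2 n) : T3 n :=
  Matrix.of fun p q => t (p.2.1, p.2.2) (q.2.1, q.2.2) * (if p.1 = q.1 then 1 else 0)

/-- The flip `t ↦ t^{21}` on `A ⊗ A`. -/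
def tflip {n : ℕ} (t : T2 n) : T2 n :=
  Matrix.of fun p q => t (p.2, p.1) (q.2, q.1)

/-- The associative Yang–Baxter equation with three spectral parameters. -/
def IsAYBESolution {n : ℕ} (r : ℂ → ℂ → ℂ → T2 n) : Prop :=
  ∀ u v y₁ y₂ y₃ : ℂ, u ≠ 0 → v ≠ 0 → u + v ≠ 0 → y₁ ≠ y₂ → y₁ ≠ y₃ → y₂ ≠ y₃ →
    emb12 (r u y₁ y₂) * emb23 (r (u + v) y₂ y₃) =
      emb13 (r (u + v) y₁ y₃) * emb12 (r (-v) y₁ y₂) + emb23 (r v y₂ y₃) * emb13 (r u y₁ y₃)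

/-- Unitarity: `r^{21}(-v; y₂, y₁) = - r(v; y₁, y₂)`. -/
def IsUnitarySolution {n : ℕ} (r : ℂ → ℂ → ℂ → T2 n) : Prop :=
  ∀ v y₁ y₂ : ℂ, v ≠ 0 → y₁ ≠ y₂ → tflip (r (-v) y₂ y₁) = - r v y₁ y₂

/-- `can : A ⊗ A → End(A)`, `X ⊗ Y ↦ (Z ↦ tr(XZ)·Y)`. -/
def canMap {n : ℕ} (t : T2 n) (Z : Mat n) : Mat n :=
  Matrix.of fun k l => ∑ i, ∑ j, t (i, k) (j, l) * Z j i

/-- Non-degeneracy: on a dense subset of the domain the tensor is invertible under `can`. -/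
def IsNonDegenerate {n : ℕ} (r : ℂ → ℂ → ℂ → T2 n) : Prop :=
  {p : ℂ × ℂ × ℂ | p.1 ≠ 0 ∧ p.2.1 ≠ p.2.2} ⊆
    closure {p : ℂ × ℂ × ℂ | p.1 ≠ 0 ∧ p.2.1 ≠ p.2.2 ∧
      Function.Bijective (canMap (r p.1 p.2.1 p.2.2))}

/-- `r` is holomorphic on `{(v,y₁,y₂) : v ≠ 0, y₁ ≠ y₂}`. -/
def IsHolomorphicOnDomain {n : ℕ} (r : ℂ → ℂ → ℂ → T2 n) : Prop :=
  DifferentiableOn ℂ (fun p : ℂ × ℂ × ℂ => r p.1 p.2.1 p.2.2)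
    {p : ℂ × ℂ × ℂ | p.1 ≠ 0 ∧ p.2.1 ≠ p.2.2}

/-- `r` is of the form (*): `r(v;y₁,y₂) = v⁻¹·1⊗1 + r₀(y₁,y₂) + v·r₁(y₁,y₂) + …`,
with Taylor coefficients `rc k`. -/
def HasLaurentForm {n : ℕ} (r : ℂ → ℂ → ℂ → T2 n) (rc : ℕ → ℂ → ℂ → T2 n) : Prop :=
  ∀ y₁ y₂ : ℂ, y₁ ≠ y₂ → ∃ ε > 0, ∀ v : ℂ, v ≠ 0 → ‖v‖ < ε →
    HasSum (fun k : ℕ => v ^ k • rc k y₁ y₂) (r v y₁ y₂ - v⁻¹ • 1)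

/-- `r` is meromorphic along the diagonal. -/
def IsMeromorphicAlongDiagonal {n : ℕ} (r : ℂ → ℂ → ℂ → T2 n) : Prop :=
  ∀ u : ℂ, u ≠ 0 → ∀ y₁ : ℂ, MeromorphicAt (fun y₂ => r u y₁ y₂) y₁

/-- `pr ⊗ id` on `A ⊗ A`, where `pr X = X - (tr X / n)·1`. -/
def prLeft {n : ℕ} (t : T2 n) : T2 n :=
  Matrix.of fun p q => t p q - if p.1 = q.1 then (∑ m, t (m, p.2) (m, q.2)) / (n : ℂ) else 0

/-- `id ⊗ pr` on `A ⊗ A`. -/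
def prRight {n : ℕ} (t : T2 n) : T2 n :=
  Matrix.of fun p q => t p q - if p.2 = q.2 then (∑ m, t (p.1, m) (q.1, m)) / (n : ℂ) else 0

/-- `pr ⊗ pr` on `A ⊗ A`. -/
def prTensorPr {n : ℕ} (t : T2 n) : T2 n := prLeft (prRight t)

/-- `c` has no infinitesimal symmetries: the only traceless `a` with
`[c(y₁,y₂), a⊗1 + 1⊗a] = 0` for all `y₁ ≠ y₂` is `a = 0`. -/
def HasNoInfinitesimalSymmetry {n : ℕ} (c : ℂ → ℂ → T2 n) : Prop :=
  ∀ a : Mat n, a.trace = 0 →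
    (∀ y₁ y₂ : ℂ, y₁ ≠ y₂ →
      c y₁ y₂ * (a ⊗ₖ (1 : Mat n) + (1 : Mat n) ⊗ₖ a) =
        (a ⊗ₖ (1 : Mat n) + (1 : Mat n) ⊗ₖ a) * c y₁ y₂) → a = 0

/-- The quantum Yang–Baxter equation. -/
def SatisfiesQYBE {n : ℕ} (q : ℂ → ℂ → T2 n) : Prop :=
  ∀ y₁ y₂ y₃ : ℂ, y₁ ≠ y₂ → y₁ ≠ y₃ → y₂ ≠ y₃ →
    emb12 (q y₁ y₂) * emb13 (q y₁ y₃) * emb23 (q y₂ y₃) =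
      emb23 (q y₂ y₃) * emb13 (q y₁ y₃) * emb12 (q y₁ y₂)

/-- The permutation tensor `P = Σ e_{ij} ⊗ e_{ji}`. -/
def Pmat (n : ℕ) : T2 n :=
  ∑ i : Fin n, ∑ j : Fin n,
    Matrix.single i j (1 : ℂ) ⊗ₖ Matrix.single j i (1 : ℂ)

/-- The classical Yang–Baxter equation. -/
def IsCYBESolution {n : ℕ} (c : ℂ → ℂ → T2 n) : Prop :=
  ∀ y₁ y₂ y₃ : ℂ, y₁ ≠ y₂ → y₁ ≠ y₃ → y₂ ≠ y₃ →
    (emb12 (c y₁ y₂) * emb23 (c y₂ y₃) - emb23 (c y₂ y₃) * emb12 (c y₁ y₂)) +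
      (emb12 (c y₁ y₂) * emb13 (c y₁ y₃) - emb13 (c y₁ y₃) * emb12 (c y₁ y₂)) +
      (emb13 (c y₁ y₃) * emb23 (c y₂ y₃) - emb23 (c y₂ y₃) * emb13 (c y₁ y₃)) = 0

/-- Unitarity for solutions of the CYBE: `c^{21}(y₂,y₁) = -c(y₁,y₂)`. -/
def IsUnitaryCYBE {n : ℕ} (c : ℂ → ℂ → T2 n) : Prop :=
  ∀ y₁ y₂ : ℂ, y₁ ≠ y₂ → tflip (c y₂ y₁) = - c y₁ y₂

/-- Non-degeneracy for an `sl_n ⊗ sl_n`-valued function: on a dense subset of `{y₁ ≠ y₂}`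
the tensor is invertible as an endomorphism of `sl_n(ℂ)` under the trace pairing. -/
def IsNonDegenerateCYBE {n : ℕ} (c : ℂ → ℂ → T2 n) : Prop :=
  {p : ℂ × ℂ | p.1 ≠ p.2} ⊆
    closure {p : ℂ × ℂ | p.1 ≠ p.2 ∧
      Set.BijOn (canMap (c p.1 p.2)) {Z : Mat n | Z.trace = 0} {Z : Mat n | Z.trace = 0}}


/-! ### Contraction operators -/

theorem canMap_add_left {n : ℕ} (s t : T2 n) (Z : Mat n) :
    canMap (s + t) Z = canMap s Z + canMap t Z := by
  ext k l
  simp [canMap, add_mul, Finset.sum_add_distrib]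

theorem canMap_smul_left {n : ℕ} (c : ℂ) (t : T2 n) (Z : Mat n) :
    canMap (c • t) Z = c • canMap t Z := by
  ext k l
  simp [canMap, Finset.mul_sum, mul_assoc]

theorem canMap_add_right {n : ℕ} (t : T2 n) (Z W : Mat n) :
    canMap t (Z + W) = canMap t Z + canMap t W := by
  ext k l
  simp [canMap, mul_add, Finset.sum_add_distrib]

theorem canMap_smul_right {n : ℕ} (c : ℂ) (t : T2 n) (Z : Mat n) :
    canMap t (c • Z) = c • canMap t Z := by
  ext k l
  simp [canMap, Finset.mul_sum, mul_left_comm]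

/-- `canMap t` as a continuous linear map. -/
def canCLM {n : ℕ} (t : T2 n) : Mat n →L[ℂ] Mat n :=
  LinearMap.toContinuousLinearMap
    { toFun := canMap t
      map_add' := canMap_add_right t
      map_smul' := fun c Z => canMap_smul_right c t Z }

@[simp] theorem canCLM_apply {n : ℕ} (t : T2 n) (Z : Mat n) : canCLM t Z = canMap t Z := rfl

/-- `t ↦ canMap t` as a continuous linear map. -/
def canOp (n : ℕ) : T2 n →L[ℂ] (Mat n →L[ℂ] Mat n) :=
  LinearMap.toContinuousLinearMap
    { toFun := fun t => canCLM t
      map_add' := fun s t => by ext1 Z; simp [canMap_add_left]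
      map_smul' := fun c t => by ext1 Z; simp [canMap_smul_left] }

@[simp] theorem canOp_apply {n : ℕ} (t : T2 n) (Z : Mat n) : canOp n t Z = canMap t Z := rfl

theorem canMap_kron {n : ℕ} (a b Z : Mat n) :
    canMap (a ⊗ₖ b) Z = (a * Z).trace • b := by
  ext k l
  simp only [canMap, Matrix.of_apply, Matrix.kroneckerMap_apply, Matrix.smul_apply, Matrix.trace,
    Matrix.diag_apply, Matrix.mul_apply, smul_eq_mul, Finset.sum_mul]
  refine Finset.sum_congr rfl fun i _ => Finset.sum_congr rfl fun j _ => by ring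

/-- flip as a continuous linear map. -/
def tflipL (n : ℕ) : T2 n →L[ℂ] T2 n :=
  LinearMap.toContinuousLinearMap
    { toFun := tflip
      map_add' := fun s t => by ext p q; simp [tflip]
      map_smul' := fun c t => by ext p q; simp [tflip] }

@[simp] theorem tflipL_apply {n : ℕ} (t : T2 n) : tflipL n t = tflip t := rfl

theorem tflip_kron {n : ℕ} (a b : Mat n) : tflip (a ⊗ₖ b) = b ⊗ₖ a := by
  ext p q
  simp [tflip, mul_comm]

theorem emb12_kron {n : ℕ} (a b : Mat n) : emb12 (a ⊗ₖ b) = a ⊗ₖ (b ⊗ₖ (1 : Mat n)) := by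
  ext p q
  simp [emb12, Matrix.one_apply, mul_assoc]

theorem emb13_kron {n : ℕ} (a b : Mat n) : emb13 (a ⊗ₖ b) = a ⊗ₖ ((1 : Mat n) ⊗ₖ b) := by
  ext p q
  simp only [emb13, Matrix.of_apply, Matrix.kroneckerMap_apply, Matrix.one_apply]
  ring

theorem emb23_kron {n : ℕ} (a b : Mat n) : emb23 (a ⊗ₖ b) = (1 : Mat n) ⊗ₖ (a ⊗ₖ b) := by
  ext p q
  simp only [emb23, Matrix.of_apply, Matrix.kroneckerMap_apply, Matrix.one_apply]
  ring

theorem emb12_add {n : ℕ} (s t : T2 n) : emb12 (s + t) = emb12 s + emb12 t := by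
  ext p q
  simp only [emb12, Matrix.of_apply, Matrix.add_apply]
  ring

theorem emb13_add {n : ℕ} (s t : T2 n) : emb13 (s + t) = emb13 s + emb13 t := by
  ext p q
  simp only [emb13, Matrix.of_apply, Matrix.add_apply]
  ring

theorem emb23_add {n : ℕ} (s t : T2 n) : emb23 (s + t) = emb23 s + emb23 t := by
  ext p q
  simp only [emb23, Matrix.of_apply, Matrix.add_apply]
  ring

theorem tflip_add {n : ℕ} (s t : T2 n) : tflip (s + t) = tflip s + tflip t := by
  ext p q
  simp [tflip]

theorem T2_induction {n : ℕ} {p : T2 n → Prop} (h0 : p 0)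
    (hadd : ∀ s t, p s → p t → p (s + t)) (hk : ∀ a b : Mat n, p (a ⊗ₖ b)) (t : T2 n) : p t := by
  rw [Matrix.matrix_eq_sum_single t]
  refine Finset.sum_induction _ p hadd h0 fun i _ => ?_
  refine Finset.sum_induction _ p hadd h0 fun j _ => ?_
  have : Matrix.single i j (t i j) =
      Matrix.single i.1 j.1 (t i j) ⊗ₖ Matrix.single i.2 j.2 (1 : ℂ) := by
    rw [Matrix.single_kronecker_single]
    simp
  rw [this]
  exact hk _ _

/-- The trilinear pairing. -/
def tri {n : ℕ} (M : T3 n) (X Y Z : Mat n) : ℂ := (M * (X ⊗ₖ (Y ⊗ₖ Z))).trace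

theorem tri_add {n : ℕ} (M N : T3 n) (X Y Z : Mat n) :
    tri (M + N) X Y Z = tri M X Y Z + tri N X Y Z := by
  simp [tri, add_mul, Matrix.trace_add]

theorem tri_sub {n : ℕ} (M N : T3 n) (X Y Z : Mat n) :
    tri (M - N) X Y Z = tri M X Y Z - tri N X Y Z := by
  simp [tri, sub_mul, Matrix.trace_sub]

theorem tri_kron {n : ℕ} (a b c X Y Z : Mat n) :
    tri (a ⊗ₖ (b ⊗ₖ c)) X Y Z = (a * X).trace * ((b * Y).trace * (c * Z).trace) := by
  simp [tri, ← Matrix.mul_kronecker_mul, Matrix.trace_kronecker]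

theorem tri_ext {n : ℕ} (M : T3 n) (h : ∀ X Y Z, tri M X Y Z = 0) : M = 0 := by
  ext p q
  have := h (Matrix.single q.1 p.1 1) (Matrix.single q.2.1 p.2.1 1) (Matrix.single q.2.2 p.2.2 1)
  rw [tri, Matrix.single_kronecker_single, Matrix.single_kronecker_single,
    Matrix.trace_mul_single] at this
  simpa using this

theorem mat_ext_trace {n : ℕ} (M : Mat n) (h : ∀ Z : Mat n, (Z * M).trace = 0) : M = 0 := by
  ext i j
  have := h (Matrix.single j i 1)
  rw [Matrix.trace_single_mul] at this
  simpa using this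

theorem canMap_zero_left {n : ℕ} (Z : Mat n) : canMap (0 : T2 n) Z = 0 := by
  ext; simp [canMap]
theorem canMap_zero_right {n : ℕ} (t : T2 n) : canMap t 0 = 0 := by
  ext; simp [canMap]
theorem emb12_zero {n : ℕ} : emb12 (0 : T2 n) = 0 := by ext; simp [emb12]
theorem emb13_zero {n : ℕ} : emb13 (0 : T2 n) = 0 := by ext; simp [emb13]
theorem emb23_zero {n : ℕ} : emb23 (0 : T2 n) = 0 := by ext; simp [emb23]
theorem tflip_zero {n : ℕ} : tflip (0 : T2 n) = 0 := by ext; simp [tflip]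

theorem tri_zero {n : ℕ} (X Y Z : Mat n) : tri 0 X Y Z = 0 := by simp [tri]

theorem tri_12_23 {n : ℕ} (s t : T2 n) (X Y Z : Mat n) :
    tri (emb12 s * emb23 t) X Y Z = (Z * canMap t (Y * canMap s X)).trace := by
  induction s using T2_induction with
  | h0 => simp [emb12_zero, canMap_zero_left, canMap_zero_right, tri_zero]
  | hadd s s' hs hs' =>
    simp only [emb12_add, add_mul, mul_add, tri_add, canMap_add_left, canMap_add_right,
      Matrix.trace_add, hs, hs']
  | hk a b =>
    induction t using T2_induction with
    | h0 => simp [emb23_zero, canMap_zero_left, tri_zero]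
    | hadd s s' hs hs' =>
      simp only [emb23_add, mul_add, tri_add, canMap_add_left, Matrix.trace_add, hs, hs']
    | hk a' b' =>
      simp only [emb12_kron, emb23_kron, ← Matrix.mul_kronecker_mul, tri_kron, canMap_kron,
        mul_one, one_mul, Matrix.mul_smul, Matrix.trace_smul, smul_eq_mul]
      rw [Matrix.trace_mul_comm b' Z, ← mul_assoc a' Y b, Matrix.trace_mul_comm (a' * Y) b,
        mul_assoc b a' Y]
      ring

theorem tri_23_12 {n : ℕ} (s t : T2 n) (X Y Z : Mat n) :
    tri (emb23 t * emb12 s) X Y Z = (Z * canMap t (canMap s X * Y)).trace := by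
  induction s using T2_induction with
  | h0 => simp [emb12_zero, canMap_zero_left, canMap_zero_right, tri_zero]
  | hadd s s' hs hs' =>
    simp only [emb12_add, add_mul, mul_add, tri_add, canMap_add_left, canMap_add_right,
      Matrix.trace_add, hs, hs']
  | hk a b =>
    induction t using T2_induction with
    | h0 => simp [emb23_zero, canMap_zero_left, tri_zero]
    | hadd s s' hs hs' =>
      simp only [emb23_add, add_mul, mul_add, tri_add, canMap_add_left, Matrix.trace_add, hs, hs']
    | hk a' b' =>
      simp only [emb12_kron, emb23_kron, ← Matrix.mul_kronecker_mul, tri_kron, canMap_kron,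
        mul_one, one_mul, Matrix.mul_smul, Matrix.smul_mul, Matrix.trace_smul, smul_eq_mul]
      rw [Matrix.trace_mul_comm b' Z, mul_assoc a' b Y]
      ring

theorem tri_12_13 {n : ℕ} (s t : T2 n) (X Y Z : Mat n) :
    tri (emb12 s * emb13 t) X Y Z = (Z * canMap t (X * canMap (tflip s) Y)).trace := by
  induction s using T2_induction with
  | h0 => simp [emb12_zero, tflip_zero, canMap_zero_left, canMap_zero_right, tri_zero]
  | hadd s s' hs hs' =>
    simp only [emb12_add, tflip_add, add_mul, mul_add, tri_add, canMap_add_left, canMap_add_right,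
      Matrix.trace_add, hs, hs']
  | hk a b =>
    induction t using T2_induction with
    | h0 => simp [emb13_zero, canMap_zero_left, tri_zero]
    | hadd s s' hs hs' =>
      simp only [emb13_add, mul_add, tri_add, canMap_add_left, Matrix.trace_add, hs, hs']
    | hk a' b' =>
      simp only [emb12_kron, emb13_kron, tflip_kron, ← Matrix.mul_kronecker_mul, tri_kron,
        canMap_kron, mul_one, one_mul, Matrix.mul_smul, Matrix.trace_smul, smul_eq_mul]
      rw [Matrix.trace_mul_comm b' Z, ← mul_assoc a' X a, Matrix.trace_mul_comm (a' * X) a,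
        mul_assoc a a' X]
      ring

theorem tri_13_12 {n : ℕ} (s t : T2 n) (X Y Z : Mat n) :
    tri (emb13 t * emb12 s) X Y Z = (Z * canMap t (canMap (tflip s) Y * X)).trace := by
  induction s using T2_induction with
  | h0 => simp [emb12_zero, tflip_zero, canMap_zero_left, canMap_zero_right, tri_zero]
  | hadd s s' hs hs' =>
    simp only [emb12_add, tflip_add, add_mul, mul_add, tri_add, canMap_add_left, canMap_add_right,
      Matrix.trace_add, hs, hs']
  | hk a b =>
    induction t using T2_induction with
    | h0 => simp [emb13_zero, canMap_zero_left, tri_zero]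
    | hadd s s' hs hs' =>
      simp only [emb13_add, add_mul, mul_add, tri_add, canMap_add_left, Matrix.trace_add, hs, hs']
    | hk a' b' =>
      simp only [emb12_kron, emb13_kron, tflip_kron, ← Matrix.mul_kronecker_mul, tri_kron,
        canMap_kron, mul_one, one_mul, Matrix.mul_smul, Matrix.smul_mul, Matrix.trace_smul,
        smul_eq_mul]
      rw [Matrix.trace_mul_comm b' Z, mul_assoc a' a X]
      ring

theorem tri_13_23 {n : ℕ} (s t : T2 n) (X Y Z : Mat n) :
    tri (emb13 s * emb23 t) X Y Z = (Z * (canMap s X * canMap t Y)).trace := by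
  induction s using T2_induction with
  | h0 => simp [emb13_zero, canMap_zero_left, tri_zero]
  | hadd s s' hs hs' =>
    simp only [emb13_add, add_mul, mul_add, tri_add, canMap_add_left,
      Matrix.trace_add, hs, hs']
  | hk a b =>
    induction t using T2_induction with
    | h0 => simp [emb23_zero, canMap_zero_left, tri_zero]
    | hadd s s' hs hs' =>
      simp only [emb23_add, mul_add, tri_add, canMap_add_left, Matrix.trace_add, hs, hs']
    | hk a' b' =>
      simp only [emb23_kron, emb13_kron, ← Matrix.mul_kronecker_mul, tri_kron,
        canMap_kron, mul_one, one_mul, Matrix.mul_smul, Matrix.smul_mul, Matrix.trace_smul,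
        smul_eq_mul]
      rw [Matrix.trace_mul_comm (b * b') Z]
      ring

theorem tri_23_13 {n : ℕ} (s t : T2 n) (X Y Z : Mat n) :
    tri (emb23 t * emb13 s) X Y Z = (Z * (canMap t Y * canMap s X)).trace := by
  induction s using T2_induction with
  | h0 => simp [emb13_zero, canMap_zero_left, tri_zero]
  | hadd s s' hs hs' =>
    simp only [emb13_add, add_mul, mul_add, tri_add, canMap_add_left,
      Matrix.trace_add, hs, hs']
  | hk a b =>
    induction t using T2_induction with
    | h0 => simp [emb23_zero, canMap_zero_left, tri_zero]
    | hadd s s' hs hs' =>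
      simp only [emb23_add, add_mul, mul_add, tri_add, canMap_add_left, Matrix.trace_add, hs, hs']
    | hk a' b' =>
      simp only [emb23_kron, emb13_kron, ← Matrix.mul_kronecker_mul, tri_kron,
        canMap_kron, mul_one, one_mul, Matrix.mul_smul, Matrix.smul_mul, Matrix.trace_smul,
        smul_eq_mul]
      rw [Matrix.trace_mul_comm (b' * b) Z]

theorem canMap_one {n : ℕ} (Z : Mat n) : canMap (1 : T2 n) Z = Z.trace • (1 : Mat n) := by
  rw [← Matrix.one_kronecker_one, canMap_kron, one_mul]

theorem canMap_inj {n : ℕ} (t : T2 n) (h : ∀ Z, canMap t Z = 0) : t = 0 := by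
  ext ⟨i, k⟩ ⟨j, l⟩
  have := congrFun (congrFun (h (Matrix.single j i 1)) k) l
  simpa [canMap, Matrix.single_apply, Finset.sum_ite_eq, ite_and] using this

/-- The operator form of the AYBE, using unitarity. -/
theorem aybe_op {n : ℕ} {r : ℂ → ℂ → ℂ → T2 n} (hA : IsAYBESolution r)
    (hU : IsUnitarySolution r) {u v y₁ y₂ y₃ : ℂ} (hu : u ≠ 0) (hv : v ≠ 0) (huv : u + v ≠ 0)
    (h12 : y₁ ≠ y₂) (h13 : y₁ ≠ y₃) (h23 : y₂ ≠ y₃) (X Y : Mat n) :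
    canOp n (r (u + v) y₂ y₃) (Y * canOp n (r u y₁ y₂) X) +
      canOp n (r (u + v) y₁ y₃) (canOp n (r v y₂ y₁) Y * X) =
    canOp n (r v y₂ y₃) Y * canOp n (r u y₁ y₃) X := by
  have h := hA u v y₁ y₂ y₃ hu hv huv h12 h13 h23
  have hf : canMap (tflip (r (-v) y₁ y₂)) Y = - canMap (r v y₂ y₁) Y := by
    rw [hU v y₂ y₁ hv h12.symm]
    have := canMap_smul_left (-1) (r v y₂ y₁) Y
    simpa using this
  rw [← sub_eq_zero]
  refine mat_ext_trace _ fun Z => ?_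
  have h2 := congrArg (fun M => tri M X Y Z) h
  simp only [tri_add, tri_12_23, tri_13_12, tri_23_13, hf] at h2
  have hneg : canMap (r (u + v) y₁ y₃) (-canMap (r v y₂ y₁) Y * X) =
      - canMap (r (u + v) y₁ y₃) (canMap (r v y₂ y₁) Y * X) := by
    have := canMap_smul_right (-1) (r (u + v) y₁ y₃) (canMap (r v y₂ y₁) Y * X)
    simpa using this
  rw [hneg] at h2
  simp only [canOp_apply, mul_sub, mul_add, Matrix.trace_sub, Matrix.trace_add, h2, mul_neg,
    Matrix.trace_neg]
  ring

/-- The projection to traceless matrices. -/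
def prM {n : ℕ} (X : Mat n) : Mat n := X - (X.trace / (n : ℂ)) • (1 : Mat n)

theorem prM_trace {n : ℕ} (hn : 2 ≤ n) (X : Mat n) : (prM X).trace = 0 := by
  have : (n : ℂ) ≠ 0 := by
    have : n ≠ 0 := by omega
    exact_mod_cast this
  simp [prM, Matrix.trace_sub, Matrix.trace_smul, this]

theorem prM_of_trace {n : ℕ} {X : Mat n} (h : X.trace = 0) : prM X = X := by simp [prM, h]

theorem canMap_prTensorPr {n : ℕ} (t : T2 n) (Z : Mat n) :
    canMap (prTensorPr t) Z = prM (canMap t (prM Z)) := by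
  have e1 : ∀ s : T2 n, canMap (prLeft s) Z = canMap s (prM Z) := by
    intro s
    induction s using T2_induction with
    | h0 => ext; simp [canMap, prLeft]
    | hadd s s' hs hs' =>
      rw [canMap_add_left, ← hs, ← hs', ← canMap_add_left]
      congr 1
      ext p q
      by_cases h : p.1 = q.1 <;> simp [prLeft, h, Finset.sum_add_distrib] <;> ring
    | hk a b =>
      have : prLeft (a ⊗ₖ b) = prM a ⊗ₖ b := by
        ext p q
        by_cases h : p.1 = q.1 <;>
          simp [prLeft, prM, h, Matrix.one_apply, ← Finset.sum_mul, Matrix.trace] <;> ring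
      rw [this, canMap_kron, canMap_kron]
      congr 1
      simp [prM, mul_sub, sub_mul, Matrix.trace_sub, Matrix.trace_smul]
      ring
  have e2 : ∀ (s : T2 n) (W : Mat n), canMap (prRight s) W = prM (canMap s W) := by
    intro s W
    induction s using T2_induction with
    | h0 => ext; simp [canMap, prRight, prM, Matrix.trace]
    | hadd s s' hs hs' =>
      have : prM (canMap (s + s') W) = prM (canMap s W) + prM (canMap s' W) := by
        simp only [prM, canMap_add_left, Matrix.trace_add, add_div, add_smul]
        abel
      rw [this, ← hs, ← hs', ← canMap_add_left]
      congr 1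
      ext p q
      by_cases h : p.2 = q.2 <;> simp [prRight, h, Finset.sum_add_distrib] <;> ring
    | hk a b =>
      have : prRight (a ⊗ₖ b) = a ⊗ₖ prM b := by
        ext p q
        by_cases h : p.2 = q.2 <;>
          simp [prRight, prM, h, Matrix.one_apply, ← Finset.mul_sum, Matrix.trace] <;> ring
      rw [this, canMap_kron, canMap_kron]
      simp only [prM, smul_sub, Matrix.trace_smul, smul_smul, smul_eq_mul]
      congr 2
      ring
  rw [prTensorPr, e1, e2]

theorem tflip_prTensorPr {n : ℕ} (t : T2 n) : tflip (prTensorPr t) = prTensorPr (tflip t) := by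
  ext ⟨i, k⟩ ⟨j, l⟩
  simp only [tflip, prTensorPr, prLeft, prRight, Matrix.of_apply]
  by_cases h1 : i = j <;> by_cases h2 : k = l <;>
    simp [h1, h2, Finset.sum_sub_distrib, ← Finset.sum_div]
  rw [Finset.sum_comm]
  ring

/-! ### An algebraic contradiction -/

theorem exists_intertwiner {n : ℕ} (hn : 2 ≤ n) (E : Mat n →ₗ[ℂ] Mat n)
    (hmul : ∀ a b, E (a * b) = E a * E b) (h1 : E 1 = 1) :
    ∃ p : Mat n, IsUnit p ∧ ∀ a, E a * p = p * a := by
  classical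
  let o : Fin n := ⟨0, by omega⟩
  have hne : E (Matrix.single o o 1) ≠ 0 := by
    intro h0
    have hz : ∀ i j, E (Matrix.single i j 1) = 0 := by
      intro i j
      have : Matrix.single i j (1 : ℂ) =
          Matrix.single i o 1 * Matrix.single o o 1 * Matrix.single o j 1 := by simp
      rw [this, hmul, hmul, h0]
      simp
    have hzero : E 1 = 0 := by
      rw [Matrix.matrix_eq_sum_single (1 : Mat n), map_sum]
      refine Finset.sum_eq_zero fun i _ => ?_
      rw [map_sum]
      refine Finset.sum_eq_zero fun j _ => ?_
      have : Matrix.single i j ((1 : Mat n) i j) = ((1 : Mat n) i j) • Matrix.single i j 1 := by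
        simp
      rw [this, map_smul, hz, smul_zero]
    rw [h1] at hzero
    have := congrFun (congrFun hzero o) o
    simp at this
  obtain ⟨i0, j0, hij⟩ : ∃ i0 j0, E (Matrix.single o o 1) i0 j0 ≠ 0 := by
    by_contra hcon
    push Not at hcon
    exact hne (by ext i j; simpa using hcon i j)
  let p : Mat n := ∑ i, E (Matrix.single i o 1) * Matrix.single j0 i 1
  have hp : ∀ a, E a * p = p * a := by
    intro a
    have e1 : ∀ i, a * Matrix.single i o 1 = ∑ k, a k i • Matrix.single k o (1 : ℂ) := by
      intro i
      ext k l
      by_cases h : o = l <;> simp [Matrix.sum_apply, Matrix.mul_apply, Matrix.single_apply, h]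
    have e2 : ∀ k, Matrix.single j0 k 1 * a = ∑ i, a k i • Matrix.single j0 i (1 : ℂ) := by
      intro k
      ext s l
      by_cases h : j0 = s <;> simp [Matrix.sum_apply, Matrix.mul_apply, Matrix.single_apply, h]
    calc E a * p = ∑ i, E (a * Matrix.single i o 1) * Matrix.single j0 i 1 := by
          simp only [p, Finset.mul_sum, ← mul_assoc, hmul]
      _ = ∑ i, ∑ k, a k i • (E (Matrix.single k o 1) * Matrix.single j0 i 1) := by
          refine Finset.sum_congr rfl fun i _ => ?_
          rw [e1, map_sum, Finset.sum_mul]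
          simp only [map_smul, Matrix.smul_mul]
      _ = ∑ k, ∑ i, a k i • (E (Matrix.single k o 1) * Matrix.single j0 i 1) :=
          Finset.sum_comm
      _ = p * a := by
          simp only [p, Finset.sum_mul, mul_assoc, e2, Finset.mul_sum, Matrix.mul_smul]
  have hp0 : p i0 o ≠ 0 := by
    have : p i0 o = E (Matrix.single o o 1) i0 j0 := by
      simp only [p, Matrix.sum_apply, Matrix.mul_apply, Matrix.single_apply]
      rw [Finset.sum_eq_single o]
      · simp
      · intro b _ hb
        simp [hb]
      · simp
    rwa [this]
  refine ⟨p, ?_, hp⟩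
  rw [Matrix.isUnit_iff_isUnit_det, isUnit_iff_ne_zero]
  intro hdet
  obtain ⟨x, hx, hpx⟩ := Matrix.exists_mulVec_eq_zero_iff.mpr hdet
  obtain ⟨s, hs⟩ := Function.ne_iff.mp hx
  have h3 := congrArg (fun q : Mat n => q *ᵥ x) (hp (Matrix.single o s 1))
  simp only [← Matrix.mulVec_mulVec, hpx, Matrix.mulVec_zero] at h3
  have h4 := congrFun h3 i0
  rw [Matrix.single_mulVec] at h4
  simp [Matrix.mulVec, dotProduct, Function.update_apply, hp0] at h4
  exact hs h4

theorem exists_unit_traceless {n : ℕ} (hn : 2 ≤ n) : ∃ X : Mat n, X.trace = 0 ∧ IsUnit X := by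
  classical
  let o : Fin n := ⟨0, by omega⟩
  refine ⟨Matrix.diagonal fun i => 1 + if i = o then -(n : ℂ) else 0, ?_, ?_⟩
  · simp [Matrix.trace, Finset.sum_add_distrib]
  · rw [Matrix.isUnit_iff_isUnit_det, isUnit_iff_ne_zero, Matrix.det_diagonal,
      Finset.prod_ne_zero_iff]
    intro i _
    by_cases h : i = o
    · simp only [h, if_true]
      intro h2
      have : (n : ℂ) = 1 := by linear_combination -h2
      have : n = 1 := by exact_mod_cast this
      omega
    · simp [h]

theorem scalar_of_commute_traceless {n : ℕ} (hn : 2 ≤ n) (z : Mat n)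
    (h : ∀ X : Mat n, X.trace = 0 → X * z = z * X) : ∃ c : ℂ, z = c • 1 := by
  have hall : ∀ X : Mat n, X * z = z * X := by
    intro X
    have := h (prM X) (prM_trace hn X)
    simpa [prM, sub_mul, mul_sub] using this
  obtain ⟨c, hc⟩ := Matrix.mem_range_scalar_of_commute_single (M := z)
    (fun i j _ => hall (Matrix.single i j 1))
  refine ⟨c, ?_⟩
  rw [← hc]
  ext i j
  simp [Matrix.diagonal_apply, Matrix.one_apply]

theorem ker_scalar {n : ℕ} (hn : 2 ≤ n) (D : Mat n →ₗ[ℂ] Mat n) (hD1 : D 1 = 0)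
    (hsurj : ∀ X : Mat n, X.trace = 0 → ∃ a, D a = X) (x : Mat n) (hx : D x = 0) :
    ∃ c : ℂ, x = c • 1 := by
  classical
  have : Nonempty (Fin n) := ⟨⟨0, by omega⟩⟩
  by_contra hcon
  push Not at hcon
  have hli : LinearIndependent ℂ ![(1 : Mat n), x] := by
    rw [LinearIndependent.pair_iff' one_ne_zero]
    intro a ha
    exact hcon a ha.symm
  have h2 : 2 ≤ Module.finrank ℂ (LinearMap.ker D) := by
    have := finrank_span_eq_card hli
    have h22 : Module.finrank ℂ (Submodule.span ℂ (Set.range ![(1 : Mat n), x])) = 2 := by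
      simpa using this
    rw [← h22]
    refine Submodule.finrank_mono (Submodule.span_le.mpr ?_)
    rintro _ ⟨i, rfl⟩
    fin_cases i
    · simpa using hD1
    · simpa using hx
  have h3 := LinearMap.finrank_range_add_finrank_ker D
  have h4 := LinearMap.finrank_range_add_finrank_ker (Matrix.traceLinearMap (Fin n) ℂ ℂ)
  have h5 : Module.finrank ℂ (LinearMap.range (Matrix.traceLinearMap (Fin n) ℂ ℂ)) ≤ 1 := by
    have := Submodule.finrank_le (LinearMap.range (Matrix.traceLinearMap (Fin n) ℂ ℂ))
    simpa using this
  have h6 : Module.finrank ℂ (LinearMap.ker (Matrix.traceLinearMap (Fin n) ℂ ℂ)) ≤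
      Module.finrank ℂ (LinearMap.range D) := by
    refine Submodule.finrank_mono ?_
    intro X hX
    exact hsurj X (by simpa using hX)
  have h7 : Module.finrank ℂ (Mat n) = Module.finrank ℂ (Matrix (Fin n) (Fin n) ℂ) := rfl
  rw [h7] at h3
  omega

theorem alg_contra {n : ℕ} (hn : 2 ≤ n) (D H : Mat n →ₗ[ℂ] Mat n)
    (hrel : ∀ a b, D (a * b) = D a * H b + H a * D b) (hD1 : D 1 = 0)
    (hsurj : ∀ X : Mat n, X.trace = 0 → ∃ a, D a = X) : False := by
  classical
  obtain ⟨X0, hX0, hX0u⟩ := exists_unit_traceless hn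
  obtain ⟨a0, ha0⟩ := hsurj X0 hX0
  obtain ⟨U, hU⟩ := hX0u
  have hUl : ∀ M : Mat n, (↑U⁻¹ : Mat n) * (X0 * M) = M := by
    intro M; rw [← mul_assoc, ← hU, Units.inv_mul, one_mul]
  have hUr : ∀ M : Mat n, M * X0 * (↑U⁻¹ : Mat n) = M := by
    intro M; rw [mul_assoc, ← hU, Units.mul_inv, mul_one]
  have cancl : ∀ M N : Mat n, X0 * M = X0 * N → M = N := by
    intro M N h; rw [← hUl M, h, hUl]
  have cancr : ∀ M N : Mat n, M * X0 = N * X0 → M = N := by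
    intro M N h; rw [← hUr M, h, hUr]
  have hH1 : H 1 = 1 := by
    have := hrel a0 1
    rw [mul_one, hD1, mul_zero, add_zero, ha0] at this
    apply cancl
    rw [← this, mul_one]
  -- the defect of multiplicativity
  obtain ⟨Δ, hΔ⟩ : ∃ Δ : Mat n → Mat n → Mat n, ∀ a b, Δ a b = H (a * b) - H a * H b :=
    ⟨fun a b => H (a * b) - H a * H b, fun _ _ => rfl⟩
  have hass : ∀ a b c, D a * Δ b c = Δ a b * D c := by
    intro a b c
    have e1 := hrel (a * b) c
    have e2 := hrel a (b * c)
    rw [mul_assoc, e2, hrel b c, hrel a b] at e1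
    rw [hΔ, hΔ]
    simp only [mul_add, add_mul, mul_sub, sub_mul, mul_assoc] at e1 ⊢
    rw [sub_eq_sub_iff_add_eq_add]
    have e3 : D a * H (b * c) + H a * (H b * D c) + H a * (D b * H c) =
      H (a * b) * D c + D a * (H b * H c) + H a * (D b * H c) := by
      rw [← sub_eq_zero] at e1 ⊢
      rw [← e1]
      abel
    exact add_right_cancel e3
  obtain ⟨z, hz⟩ : ∃ z : Mat n, ∀ b c, Δ b c = D b * z * D c := by
    have g1 : ∀ b c, Δ b c = (↑U⁻¹ * Δ a0 b) * D c := by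
      intro b c
      rw [mul_assoc, ← hass a0 b c, ha0, hUl]
    have g2 : ∀ a b, Δ a b = D a * (Δ b a0 * ↑U⁻¹) := by
      intro a b
      rw [← mul_assoc, hass a b a0, ha0, hUr]
    refine ⟨(Δ a0 a0 * ↑U⁻¹) * ↑U⁻¹, fun b c => ?_⟩
    have g3 : (↑U⁻¹ * Δ a0 b) = D b * (Δ a0 a0 * ↑U⁻¹ * ↑U⁻¹) := by
      apply cancr
      have := (g1 b a0).symm.trans (g2 b a0)
      rw [ha0] at this
      rw [this]
      rw [mul_assoc (D b), mul_assoc (Δ a0 a0 * ↑U⁻¹), ← hU, Units.inv_mul, mul_one]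
    rw [g1, g3]
  have hzc : ∀ X : Mat n, X.trace = 0 → X * z = z * X := by
    intro X hX
    obtain ⟨b, rfl⟩ := hsurj X hX
    have := hass a0 b a0
    rw [hz, hz, ha0] at this
    apply cancl
    apply cancr
    simpa only [mul_assoc] using this
  obtain ⟨c, hc⟩ := scalar_of_commute_traceless hn z hzc
  obtain ⟨μ, hμ⟩ := IsAlgClosed.exists_pow_nat_eq c (n := 2) (by norm_num)
  have hHm : ∀ a b, H (a * b) = H a * H b + (μ ^ 2) • (D a * D b) := by
    intro a b
    have := hz a b
    rw [hΔ, hc] at this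
    rw [hμ]
    rw [sub_eq_iff_eq_add] at this
    rw [this]
    simp
    abel
  have hEm : ∀ ν : ℂ, ν ^ 2 = μ ^ 2 → ∀ a b,
      (H + ν • D) (a * b) = (H + ν • D) a * (H + ν • D) b := by
    intro ν hν a b
    simp only [LinearMap.add_apply, LinearMap.smul_apply, hHm, hrel, ← hν, mul_add, add_mul,
      smul_add, Matrix.smul_mul, Matrix.mul_smul, smul_smul, pow_two]
    abel
  have hE1 : ∀ ν : ℂ, (H + ν • D) 1 = 1 := by
    intro ν
    simp [hH1, hD1]
  obtain ⟨E, hE⟩ : ∃ E, E = H + μ • D := ⟨_, rfl⟩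
  obtain ⟨F, hF⟩ : ∃ F, F = H + (-μ) • D := ⟨_, rfl⟩
  have hEmul := hEm μ rfl
  have hFmul := hEm (-μ) (by ring)
  have hEone := hE1 μ
  have hFone := hE1 (-μ)
  rw [← hE] at hEmul hEone
  rw [← hF] at hFmul hFone
  have hDEF : ∀ a b, D (a * b) = E a * D b + D a * F b := by
    intro a b
    rw [hrel, hE, hF]
    simp only [LinearMap.add_apply, LinearMap.smul_apply, mul_add, add_mul, Matrix.smul_mul,
      Matrix.mul_smul, neg_smul, mul_neg]
    abel
  obtain ⟨p, hpu, hp⟩ := exists_intertwiner hn E hEmul hEone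
  obtain ⟨q, hqu, hq⟩ := exists_intertwiner hn F hFmul hFone
  let o : Fin n := ⟨0, by omega⟩
  obtain ⟨m, hm⟩ : ∃ m : Mat n, m = ∑ i, E (Matrix.single i o 1) * D (Matrix.single o i 1) :=
    ⟨_, rfl⟩
  have hone : (∑ i : Fin n, Matrix.single i o (1 : ℂ) * Matrix.single o i 1) = (1 : Mat n) := by
    ext k l
    simp only [Matrix.single_mul_single_same, mul_one, Matrix.sum_apply, Matrix.single_apply,
      Matrix.one_apply]
    by_cases h : k = l
    · subst h; simp
    · rw [if_neg h]
      refine Finset.sum_eq_zero fun i _ => ?_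
      rw [if_neg]
      rintro ⟨rfl, rfl⟩
      exact h rfl
  have hm' : (∑ i, D (Matrix.single i o 1) * F (Matrix.single o i 1)) = -m := by
    rw [eq_neg_iff_add_eq_zero, hm, ← Finset.sum_add_distrib, ← hD1, ← hone, map_sum]
    refine Finset.sum_congr rfl fun i _ => ?_
    rw [hDEF, add_comm]
  have hinner : ∀ a, D a = E a * m - m * F a := by
    intro a
    have e1 : ∀ i, a * Matrix.single i o 1 = ∑ k, a k i • Matrix.single k o (1 : ℂ) := by
      intro i
      ext k l
      by_cases h : o = l <;> simp [Matrix.sum_apply, Matrix.mul_apply, Matrix.single_apply, h]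
    have e2 : ∀ k, Matrix.single o k 1 * a = ∑ i, a k i • Matrix.single o i (1 : ℂ) := by
      intro k
      ext s l
      by_cases h : o = s <;> simp [Matrix.sum_apply, Matrix.mul_apply, Matrix.single_apply, h]
    have s1 : E a * m = D a - ∑ i, D (a * Matrix.single i o 1) * F (Matrix.single o i 1) := by
      have : ∀ i, E a * (E (Matrix.single i o 1) * D (Matrix.single o i 1)) =
          D (a * (Matrix.single i o 1 * Matrix.single o i 1)) -
            D (a * Matrix.single i o 1) * F (Matrix.single o i 1) := by
        intro i
        rw [← mul_assoc a, hDEF (a * Matrix.single i o 1), hEmul, mul_assoc]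
        abel
      rw [hm, Finset.mul_sum, Finset.sum_congr rfl fun i _ => this i, Finset.sum_sub_distrib,
        ← map_sum, ← Finset.mul_sum, hone, mul_one]
    have s2 : ∑ i, D (a * Matrix.single i o 1) * F (Matrix.single o i 1) = - m * F a := by
      rw [← hm', Finset.sum_mul]
      simp only [mul_assoc, ← hFmul, e1, e2, map_sum, map_smul, Finset.sum_mul, Finset.mul_sum,
        Matrix.smul_mul, Matrix.mul_smul]
      rw [Finset.sum_comm]
    rw [s1, s2]
    simp
  obtain ⟨P, rfl⟩ := hpu
  obtain ⟨Q, rfl⟩ := hqu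
  have hE' : ∀ a, E a = P * a * ↑P⁻¹ := by
    intro a; rw [← hp a, mul_assoc, Units.mul_inv, mul_one]
  have hF' : ∀ a, F a = Q * a * ↑Q⁻¹ := by
    intro a; rw [← hq a, mul_assoc, Units.mul_inv, mul_one]
  obtain ⟨d, hd⟩ := ker_scalar hn D hD1 hsurj (↑P⁻¹ * m * ↑Q) (by
    rw [hinner, hE', hF']
    simp only [← mul_assoc, Units.mul_inv, one_mul]
    simp only [mul_assoc, Units.mul_inv, mul_one, Units.inv_mul_cancel_left,
      Units.mul_inv_cancel_left]
    simp)
  have hmd : m = d • ((P : Mat n) * ↑Q⁻¹) := by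
    have : m = P * (↑P⁻¹ * m * ↑Q) * ↑Q⁻¹ := by
      simp only [mul_assoc, Units.mul_inv, mul_one, Units.mul_inv_cancel_left]
    rw [this, hd]
    simp
  have hD0 : D a0 = 0 := by
    rw [hinner, hE', hF', hmd]
    simp only [Matrix.mul_smul, Matrix.smul_mul, mul_assoc, Units.inv_mul_cancel_left, sub_self]
  rw [ha0] at hD0
  have : Nonempty (Fin n) := ⟨⟨0, by omega⟩⟩
  exact U.ne_zero (hU.trans hD0)

/-! ### Limits at `v = 0`, unitarity and the CYBE -/

theorem canMap_lim {n : ℕ} {α : Type*} {l : Filter α} {T : α → T2 n} {T0 : T2 n} {f : α → Mat n}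
    {x : Mat n} (hT : Tendsto T l (𝓝 T0)) (hf : Tendsto f l (𝓝 x)) :
    Tendsto (fun a => canMap (T a) (f a)) l (𝓝 (canMap T0 x)) := by
  have h : Continuous fun p : T2 n × Mat n => canMap p.1 p.2 := by
    refine continuous_matrix fun k l => ?_
    simp only [canMap, Matrix.of_apply]
    refine continuous_finsetSum _ fun i _ => continuous_finsetSum _ fun j _ => ?_
    exact (continuous_fst.matrix_elem _ _).mul (continuous_snd.matrix_elem _ _)
  have h2 : Tendsto (fun a => (T a, f a)) l (𝓝 (T0, x)) := hT.prodMk_nhds hf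
  have h3 := (h.tendsto (T0, x)).comp h2
  exact h3

theorem canMap_sub_left {n : ℕ} (s t : T2 n) (X : Mat n) :
    canMap (s - t) X = canMap s X - canMap t X := by
  rw [sub_eq_add_neg, canMap_add_left, sub_eq_add_neg]
  have := canMap_smul_left (-1) t X
  simpa using this

theorem aybe_op' {n : ℕ} {r : ℂ → ℂ → ℂ → T2 n} (hA : IsAYBESolution r)
    (hU : IsUnitarySolution r) {u v y₁ y₂ y₃ : ℂ} (hu : u ≠ 0) (hv : v ≠ 0) (huv : u + v ≠ 0)
    (h12 : y₁ ≠ y₂) (h13 : y₁ ≠ y₃) (h23 : y₂ ≠ y₃) (X Y : Mat n) :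
    canMap (r (u + v) y₂ y₃) (Y * canMap (r u y₁ y₂) X) +
      canMap (r (u + v) y₁ y₃) (canMap (r v y₂ y₁) Y * X) =
    canMap (r v y₂ y₃) Y * canMap (r u y₁ y₃) X :=
  aybe_op hA hU hu hv huv h12 h13 h23 X Y

/-- The regular part of `r` in the first variable. -/
def regPart {n : ℕ} (r : ℂ → ℂ → ℂ → T2 n) (rc : ℕ → ℂ → ℂ → T2 n) (y z v : ℂ) : T2 n :=
  if v = 0 then rc 0 y z else r v y z - v⁻¹ • 1

theorem regPart_analyticAt {n : ℕ} {r : ℂ → ℂ → ℂ → T2 n} {rc : ℕ → ℂ → ℂ → T2 n}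
    (hF : HasLaurentForm r rc) {y z : ℂ} (hyz : y ≠ z) :
    AnalyticAt ℂ (regPart r rc y z) 0 := by
  obtain ⟨ε, hε, h⟩ := hF y z hyz
  let p : FormalMultilinearSeries ℂ ℂ (T2 n) :=
    fun k => ContinuousMultilinearMap.mkPiRing ℂ (Fin k) (rc k y z)
  refine ⟨p, hasFPowerSeriesAt_iff.mpr ?_⟩
  filter_upwards [Metric.ball_mem_nhds (0 : ℂ) hε] with v hv
  have hc : ∀ k, p.coeff k = rc k y z := by
    intro k
    refine (ContinuousMultilinearMap.mkPiRing_apply _ _).trans ?_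
    simp
  simp only [hc, zero_add]
  by_cases hv0 : v = 0
  · subst hv0
    simp only [regPart, if_true]
    have := hasSum_single (f := fun k : ℕ => (0 : ℂ) ^ k • rc k y z) 0 (by
      intro k hk
      simp [hk])
    rw [pow_zero, one_smul] at this
    exact this
  · simp only [regPart, if_neg hv0]
    exact h v hv0 (by simpa using hv)

theorem tendsto_rc0 {n : ℕ} {r : ℂ → ℂ → ℂ → T2 n} {rc : ℕ → ℂ → ℂ → T2 n}
    (hF : HasLaurentForm r rc) {y z : ℂ} (hyz : y ≠ z) :
    Tendsto (fun v => r v y z - v⁻¹ • 1) (𝓝[≠] 0) (𝓝 (rc 0 y z)) := by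
  have h := (regPart_analyticAt hF hyz).continuousAt.tendsto
  have h0 : regPart r rc y z 0 = rc 0 y z := by simp [regPart]
  rw [h0] at h
  refine (h.mono_left nhdsWithin_le_nhds).congr' ?_
  filter_upwards [self_mem_nhdsWithin] with v hv
  simp only [regPart, if_neg (show v ≠ 0 from hv)]

theorem tendsto_canOp_rc0 {n : ℕ} {r : ℂ → ℂ → ℂ → T2 n} {rc : ℕ → ℂ → ℂ → T2 n}
    (hF : HasLaurentForm r rc) {y z : ℂ} (hyz : y ≠ z) {X : Mat n} (hX : X.trace = 0) :
    Tendsto (fun v => canMap (r v y z) X) (𝓝[≠] 0) (𝓝 (canMap (rc 0 y z) X)) := by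
  have h2 := canMap_lim (tendsto_rc0 hF hyz) (tendsto_const_nhds (x := X))
  refine h2.congr fun v => ?_
  rw [canMap_sub_left, canMap_smul_left, canMap_one, hX]
  simp

theorem r_continuousAt {n : ℕ} {r : ℂ → ℂ → ℂ → T2 n} (hH : IsHolomorphicOnDomain r)
    {v y z : ℂ} (hv : v ≠ 0) (hyz : y ≠ z) :
    DifferentiableAt ℂ (fun p : ℂ × ℂ × ℂ => r p.1 p.2.1 p.2.2) (v, y, z) := by
  refine (hH (v, y, z) ⟨hv, hyz⟩).differentiableAt ?_
  refine IsOpen.mem_nhds ?_ ⟨hv, hyz⟩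
  exact (isOpen_ne_fun continuous_fst continuous_const).inter
    (isOpen_ne_fun continuous_snd.fst continuous_snd.snd)

theorem r_cont_v {n : ℕ} {r : ℂ → ℂ → ℂ → T2 n} (hH : IsHolomorphicOnDomain r)
    {v y z : ℂ} (hv : v ≠ 0) (hyz : y ≠ z) : DifferentiableAt ℂ (fun u => r u y z) v := by
  have h := r_continuousAt hH hv hyz
  exact DifferentiableAt.comp (g := fun p : ℂ × ℂ × ℂ => r p.1 p.2.1 p.2.2)
    (f := fun u : ℂ => (u, y, z)) v h (by fun_prop)

theorem r_cont_2 {n : ℕ} {r : ℂ → ℂ → ℂ → T2 n} (hH : IsHolomorphicOnDomain r)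
    {v y z : ℂ} (hv : v ≠ 0) (hyz : y ≠ z) : DifferentiableAt ℂ (fun x => r v x z) y := by
  have h := r_continuousAt hH hv hyz
  exact DifferentiableAt.comp (g := fun p : ℂ × ℂ × ℂ => r p.1 p.2.1 p.2.2)
    (f := fun x : ℂ => (v, x, z)) y h (by fun_prop)

theorem r_cont_3 {n : ℕ} {r : ℂ → ℂ → ℂ → T2 n} (hH : IsHolomorphicOnDomain r)
    {v y z : ℂ} (hv : v ≠ 0) (hyz : y ≠ z) : DifferentiableAt ℂ (fun x => r v y x) z := by
  have h := r_continuousAt hH hv hyz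
  exact DifferentiableAt.comp (g := fun p : ℂ × ℂ × ℂ => r p.1 p.2.1 p.2.2)
    (f := fun x : ℂ => (v, y, x)) z h (by fun_prop)

theorem aybe_zero {n : ℕ} {r : ℂ → ℂ → ℂ → T2 n} {rc : ℕ → ℂ → ℂ → T2 n}
    (hA : IsAYBESolution r) (hU : IsUnitarySolution r) (hH : IsHolomorphicOnDomain r)
    (hF : HasLaurentForm r rc) {v y₁ y₂ y₃ : ℂ} (hv : v ≠ 0)
    (h12 : y₁ ≠ y₂) (h13 : y₁ ≠ y₃) (h23 : y₂ ≠ y₃) (X Y : Mat n) (hX : X.trace = 0) :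
    canMap (r v y₂ y₃) (Y * canMap (rc 0 y₁ y₂) X) +
      canMap (r v y₁ y₃) (canMap (r v y₂ y₁) Y * X) =
    canMap (r v y₂ y₃) Y * canMap (rc 0 y₁ y₃) X := by
  have hadd : Tendsto (fun u : ℂ => u + v) (𝓝[≠] 0) (𝓝 v) := by
    have : Tendsto (fun u : ℂ => u + v) (𝓝 0) (𝓝 (0 + v)) :=
      (continuous_id.add continuous_const).tendsto 0
    rw [zero_add] at this
    exact this.mono_left nhdsWithin_le_nhds
  have hC : ∀ {a b : ℂ}, a ≠ b → Tendsto (fun u => r (u + v) a b) (𝓝[≠] 0)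
      (𝓝 (r v a b)) := fun {a b} hab =>
    (r_cont_v hH hv hab).continuousAt.tendsto.comp hadd
  have l1 := canMap_lim (hC h23) ((tendsto_const_nhds (x := Y)).mul (tendsto_canOp_rc0 hF h12 hX))
  have l2 := canMap_lim (hC h13) (tendsto_const_nhds (x := canMap (r v y₂ y₁) Y * X))
  have l3 := (tendsto_const_nhds (x := canMap (r v y₂ y₃) Y)).mul (tendsto_canOp_rc0 hF h13 hX)
  refine tendsto_nhds_unique ((l1.add l2).congr' ?_) l3
  have hne : ∀ᶠ u in 𝓝[≠] (0 : ℂ), u + v ≠ 0 := hadd.eventually_ne hv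
  filter_upwards [self_mem_nhdsWithin, hne] with u hu huv
  exact aybe_op' hA hU hu hv huv h12 h13 h23 X Y

theorem prM_add {n : ℕ} (X Y : Mat n) : prM (X + Y) = prM X + prM Y := by
  simp only [prM, Matrix.trace_add, add_div, add_smul]; abel

theorem prM_sub {n : ℕ} (X Y : Mat n) : prM (X - Y) = prM X - prM Y := by
  simp only [prM, Matrix.trace_sub, sub_div, sub_smul]; abel

theorem prM_smul {n : ℕ} (c : ℂ) (X : Mat n) : prM (c • X) = c • prM X := by
  simp only [prM, Matrix.trace_smul, smul_sub, smul_smul, smul_eq_mul, mul_div_assoc]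

theorem prM_one {n : ℕ} (hn : 2 ≤ n) : prM (1 : Mat n) = 0 := by
  have : (n : ℂ) ≠ 0 := by
    have : n ≠ 0 := by omega
    exact_mod_cast this
  simp [prM, this]

theorem prM_continuous {n : ℕ} : Continuous (prM : Mat n → Mat n) := by
  unfold prM
  fun_prop

theorem tendsto_prM_canOp {n : ℕ} (hn : 2 ≤ n) {r : ℂ → ℂ → ℂ → T2 n} {rc : ℕ → ℂ → ℂ → T2 n}
    (hF : HasLaurentForm r rc) {y z : ℂ} (hyz : y ≠ z) {f : ℂ → Mat n} {X : Mat n}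
    (hf : Tendsto f (𝓝[≠] 0) (𝓝 X)) :
    Tendsto (fun v => prM (canMap (r v y z) (f v))) (𝓝[≠] 0)
      (𝓝 (prM (canMap (rc 0 y z) X))) := by
  have h2 := (prM_continuous.tendsto _).comp (canMap_lim (tendsto_rc0 hF hyz) hf)
  refine h2.congr fun v => ?_
  simp only [Function.comp]
  rw [canMap_sub_left, canMap_smul_left, canMap_one, prM_sub, prM_smul, prM_smul, prM_one hn]
  simp

theorem cybe_half {n : ℕ} (hn : 2 ≤ n) {r : ℂ → ℂ → ℂ → T2 n} {rc : ℕ → ℂ → ℂ → T2 n}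
    (hA : IsAYBESolution r) (hU : IsUnitarySolution r) (hH : IsHolomorphicOnDomain r)
    (hF : HasLaurentForm r rc) {y₁ y₂ y₃ : ℂ}
    (h12 : y₁ ≠ y₂) (h13 : y₁ ≠ y₃) (h23 : y₂ ≠ y₃) (X Y : Mat n) (hX : X.trace = 0)
    (hY : Y.trace = 0) :
    prM (canMap (rc 0 y₂ y₃) (Y * canMap (rc 0 y₁ y₂) X)) +
      prM (canMap (rc 0 y₁ y₃) (canMap (rc 0 y₂ y₁) Y * X)) =
    prM (canMap (rc 0 y₂ y₃) Y * canMap (rc 0 y₁ y₃) X) := by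
  have l1 := tendsto_prM_canOp hn hF h23
    (tendsto_const_nhds (x := Y * canMap (rc 0 y₁ y₂) X))
  have l2 := tendsto_prM_canOp hn hF h13
    ((tendsto_canOp_rc0 hF h12.symm hY).mul (tendsto_const_nhds (x := X)))
  have l3 := (prM_continuous.tendsto _).comp
    ((tendsto_canOp_rc0 hF h23 hY).mul (tendsto_const_nhds (x := canMap (rc 0 y₁ y₃) X)))
  refine tendsto_nhds_unique ((l1.add l2).congr' ?_) l3
  filter_upwards [self_mem_nhdsWithin] with v hv
  rw [← prM_add, aybe_zero hA hU hH hF hv h12 h13 h23 X Y hX]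
  rfl

theorem rc0_unitary {n : ℕ} {r : ℂ → ℂ → ℂ → T2 n} {rc : ℕ → ℂ → ℂ → T2 n}
    (hU : IsUnitarySolution r) (hF : HasLaurentForm r rc) {y₁ y₂ : ℂ} (h12 : y₁ ≠ y₂) :
    tflip (rc 0 y₂ y₁) = - rc 0 y₁ y₂ := by
  have hneg : Tendsto (fun v : ℂ => -v) (𝓝[≠] 0) (𝓝[≠] 0) := by
    refine tendsto_nhdsWithin_iff.mpr ⟨?_, ?_⟩
    · have : Tendsto (fun v : ℂ => -v) (𝓝 0) (𝓝 (-0)) := continuous_neg.tendsto 0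
      rw [neg_zero] at this
      exact this.mono_left nhdsWithin_le_nhds
    · filter_upwards [self_mem_nhdsWithin] with v hv
      simpa using hv
  have l1 := ((tflipL n).continuous.tendsto _).comp ((tendsto_rc0 hF h12.symm).comp hneg)
  have l2 := (tendsto_rc0 hF h12).neg
  refine tendsto_nhds_unique (l1.congr' ?_) l2
  filter_upwards [self_mem_nhdsWithin] with v hv
  have h1 : tflip (1 : T2 n) = 1 := by
    rw [← Matrix.one_kronecker_one, tflip_kron]
  simp only [Function.comp, map_sub, map_smul, tflipL_apply, hU v y₁ y₂ hv h12, h1]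
  simp [inv_neg]
  abel

theorem canMap_sub_right {n : ℕ} (t : T2 n) (X Y : Mat n) :
    canMap t (X - Y) = canMap t X - canMap t Y :=
  map_sub (canOp n t) X Y

theorem canMap_neg_left {n : ℕ} (t : T2 n) (X : Mat n) : canMap (-t) X = - canMap t X := by
  have := canMap_smul_left (-1) t X
  simpa using this

theorem canMap_neg_right {n : ℕ} (t : T2 n) (X : Mat n) : canMap t (-X) = - canMap t X :=
  map_neg (canOp n t) X

theorem part_unitary {n : ℕ} {r : ℂ → ℂ → ℂ → T2 n} {rc : ℕ → ℂ → ℂ → T2 n}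
    (hU : IsUnitarySolution r) (hF : HasLaurentForm r rc) :
    IsUnitaryCYBE (fun y₁ y₂ => prTensorPr (rc 0 y₁ y₂)) := by
  intro y₁ y₂ h
  change tflip (prTensorPr (rc 0 y₂ y₁)) = - prTensorPr (rc 0 y₁ y₂)
  rw [tflip_prTensorPr, rc0_unitary hU hF h]
  rw [eq_neg_iff_add_eq_zero]
  refine canMap_inj _ fun Z => ?_
  rw [canMap_add_left, canMap_prTensorPr, canMap_prTensorPr, canMap_neg_left, ← prM_add]
  simp [prM]

theorem comm_prM_right {n : ℕ} (Y Z : Mat n) : Y * prM Z - prM Z * Y = Y * Z - Z * Y := by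
  simp [prM, mul_sub, sub_mul]

theorem comm_trace {n : ℕ} (Y Z : Mat n) : (Y * Z - Z * Y).trace = 0 := by
  rw [Matrix.trace_sub, Matrix.trace_mul_comm, sub_self]

theorem part_cybe {n : ℕ} (hn : 2 ≤ n) {r : ℂ → ℂ → ℂ → T2 n} {rc : ℕ → ℂ → ℂ → T2 n}
    (hA : IsAYBESolution r) (hU : IsUnitarySolution r) (hH : IsHolomorphicOnDomain r)
    (hF : HasLaurentForm r rc) :
    IsCYBESolution (fun y₁ y₂ => prTensorPr (rc 0 y₁ y₂)) := by
  intro y₁ y₂ y₃ h12 h13 h23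
  have hun : tflip (prTensorPr (rc 0 y₁ y₂)) = - prTensorPr (rc 0 y₂ y₁) :=
    part_unitary hU hF y₂ y₁ h12.symm
  refine tri_ext _ fun X Y Z => ?_
  simp only [tri_add, tri_sub, tri_12_23, tri_23_12, tri_12_13, tri_13_12, tri_13_23, tri_23_13,
    hun]
  simp only [← Matrix.trace_sub, ← Matrix.trace_add, ← mul_sub, ← mul_add, ← canMap_sub_right]
  suffices h : canMap (prTensorPr (rc 0 y₂ y₃))
        (Y * canMap (prTensorPr (rc 0 y₁ y₂)) X - canMap (prTensorPr (rc 0 y₁ y₂)) X * Y) +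
      canMap (prTensorPr (rc 0 y₁ y₃))
        (X * canMap (-prTensorPr (rc 0 y₂ y₁)) Y - canMap (-prTensorPr (rc 0 y₂ y₁)) Y * X) +
      (canMap (prTensorPr (rc 0 y₁ y₃)) X * canMap (prTensorPr (rc 0 y₂ y₃)) Y -
        canMap (prTensorPr (rc 0 y₂ y₃)) Y * canMap (prTensorPr (rc 0 y₁ y₃)) X) = 0 by
    rw [h]; simp
  have a1 := cybe_half hn hA hU hH hF h12 h13 h23 (prM X) (prM Y) (prM_trace hn X) (prM_trace hn Y)
  have a2 := cybe_half hn hA hU hH hF h12.symm h23 h13 (prM Y) (prM X) (prM_trace hn Y)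
    (prM_trace hn X)
  have hl : ∀ A B : Mat n, prM A * B - B * prM A = A * B - B * A := by
    intro A B; simp [prM, mul_sub, sub_mul]
  have e1 : canMap (prTensorPr (rc 0 y₂ y₃))
        (Y * canMap (prTensorPr (rc 0 y₁ y₂)) X - canMap (prTensorPr (rc 0 y₁ y₂)) X * Y) =
      prM (canMap (rc 0 y₂ y₃) (prM Y * canMap (rc 0 y₁ y₂) (prM X))) -
      prM (canMap (rc 0 y₂ y₃) (canMap (rc 0 y₁ y₂) (prM X) * prM Y)) := by
    rw [canMap_prTensorPr, prM_of_trace (comm_trace _ _), canMap_prTensorPr, comm_prM_right,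
      ← hl Y, canMap_sub_right, prM_sub]
  have e2 : canMap (prTensorPr (rc 0 y₁ y₃))
        (X * canMap (-prTensorPr (rc 0 y₂ y₁)) Y - canMap (-prTensorPr (rc 0 y₂ y₁)) Y * X) =
      prM (canMap (rc 0 y₁ y₃) (canMap (rc 0 y₂ y₁) (prM Y) * prM X)) -
      prM (canMap (rc 0 y₁ y₃) (prM X * canMap (rc 0 y₂ y₁) (prM Y))) := by
    rw [canMap_prTensorPr, prM_of_trace (comm_trace _ _), canMap_neg_left, canMap_prTensorPr]
    have : X * -prM (canMap (rc 0 y₂ y₁) (prM Y)) - -prM (canMap (rc 0 y₂ y₁) (prM Y)) * X =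
        canMap (rc 0 y₂ y₁) (prM Y) * prM X - prM X * canMap (rc 0 y₂ y₁) (prM Y) := by
      rw [mul_neg, neg_mul, sub_neg_eq_add, neg_add_eq_sub, hl, comm_prM_right]
    rw [this, canMap_sub_right, prM_sub]
  have e3 : canMap (prTensorPr (rc 0 y₁ y₃)) X * canMap (prTensorPr (rc 0 y₂ y₃)) Y -
        canMap (prTensorPr (rc 0 y₂ y₃)) Y * canMap (prTensorPr (rc 0 y₁ y₃)) X =
      prM (canMap (rc 0 y₁ y₃) (prM X) * canMap (rc 0 y₂ y₃) (prM Y)) -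
      prM (canMap (rc 0 y₂ y₃) (prM Y) * canMap (rc 0 y₁ y₃) (prM X)) := by
    rw [canMap_prTensorPr, canMap_prTensorPr, hl, comm_prM_right, ← prM_sub,
      prM_of_trace (comm_trace _ _)]
  rw [e1, e2, e3, ← a1, ← a2]
  abel

/-! ### Inverses of the operators `canMap t` -/

/-- The matrix of `canMap t`. -/
def canMat {n : ℕ} (t : T2 n) : T2 n := Matrix.of fun p q => t (q.2, p.1) (q.1, p.2)

/-- The determinant of `canMap t`. -/
def canDet {n : ℕ} (t : T2 n) : ℂ := (canMat t).det

/-- `canMap t` as a linear map. -/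
def canL {n : ℕ} (t : T2 n) : Mat n →ₗ[ℂ] Mat n :=
  { toFun := canMap t
    map_add' := canMap_add_right t
    map_smul' := fun c Z => canMap_smul_right c t Z }

/-- The inverse of `canMap t` when `canDet t ≠ 0`. -/
def canInv {n : ℕ} (t : T2 n) : Mat n →ₗ[ℂ] Mat n :=
  { toFun := fun Z => Matrix.of fun k l => ((canMat t)⁻¹ *ᵥ fun q => Z q.1 q.2) (k, l)
    map_add' := fun X Y => by
      ext k l
      have : (fun q : Fin n × Fin n => (X + Y) q.1 q.2) =
        (fun q => X q.1 q.2) + fun q => Y q.1 q.2 := rfl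
      simp only [Matrix.of_apply, Matrix.add_apply (Matrix.of _)]
      rw [this, Matrix.mulVec_add]
      rfl
    map_smul' := fun c X => by
      ext k l
      have : (fun q : Fin n × Fin n => (c • X) q.1 q.2) = c • (fun q => X q.1 q.2) := rfl
      simp only [Matrix.of_apply, Matrix.smul_apply c (Matrix.of _), RingHom.id_apply]
      rw [this, Matrix.mulVec_smul]
      rfl }

theorem canMap_eq_mulVec {n : ℕ} (t : T2 n) (Z : Mat n) :
    (fun q : Fin n × Fin n => canMap t Z q.1 q.2) = canMat t *ᵥ fun q => Z q.1 q.2 := by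
  ext ⟨k, l⟩
  simp only [canMap, canMat, Matrix.of_apply, Matrix.mulVec, dotProduct, Fintype.sum_prod_type]
  rw [Finset.sum_comm]

theorem canInv_eq_mulVec {n : ℕ} (t : T2 n) (Z : Mat n) :
    (fun q : Fin n × Fin n => canInv t Z q.1 q.2) = (canMat t)⁻¹ *ᵥ fun q => Z q.1 q.2 := rfl

theorem mat_vec_ext {n : ℕ} {X Y : Mat n}
    (h : (fun q : Fin n × Fin n => X q.1 q.2) = fun q => Y q.1 q.2) : X = Y := by
  ext i j
  exact congrFun h (i, j)

theorem canInv_left {n : ℕ} {t : T2 n} (h : canDet t ≠ 0) (Z : Mat n) :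
    canInv t (canMap t Z) = Z := by
  apply mat_vec_ext
  rw [canInv_eq_mulVec, canMap_eq_mulVec, Matrix.mulVec_mulVec,
    Matrix.nonsing_inv_mul _ (isUnit_iff_ne_zero.mpr h), Matrix.one_mulVec]

theorem canInv_right {n : ℕ} {t : T2 n} (h : canDet t ≠ 0) (Z : Mat n) :
    canMap t (canInv t Z) = Z := by
  apply mat_vec_ext
  rw [canMap_eq_mulVec, canInv_eq_mulVec, Matrix.mulVec_mulVec,
    Matrix.mul_nonsing_inv _ (isUnit_iff_ne_zero.mpr h), Matrix.one_mulVec]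

theorem canDet_ne_zero_of_injective {n : ℕ} {t : T2 n} (h : ∀ Z, canMap t Z = 0 → Z = 0) :
    canDet t ≠ 0 := by
  intro hdet
  obtain ⟨x, hx, hpx⟩ := Matrix.exists_mulVec_eq_zero_iff.mpr hdet
  apply hx
  have hz := h (Matrix.of fun i j => x (i, j)) (by
    apply mat_vec_ext
    rw [canMap_eq_mulVec]
    exact hpx)
  ext ⟨i, j⟩
  exact congrFun (congrFun hz i) j

theorem canMat_continuous {n : ℕ} : Continuous (canMat : T2 n → T2 n) := by
  refine continuous_matrix fun k l => ?_
  exact continuous_id.matrix_elem _ _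

theorem canDet_continuous {n : ℕ} : Continuous (canDet : T2 n → ℂ) :=
  canMat_continuous.matrix_det

theorem elem_differentiableAt {n : ℕ} {f : ℂ → T2 n} {x : ℂ} (hf : DifferentiableAt ℂ f x)
    (p q : Fin n × Fin n) : DifferentiableAt ℂ (fun v => f v p q) x := by
  have h1 : DifferentiableAt ℂ (fun v => f v p) x := differentiableAt_pi.mp hf p
  exact differentiableAt_pi.mp h1 q

theorem canDet_differentiableAt {n : ℕ} {f : ℂ → T2 n} {x : ℂ} (hf : DifferentiableAt ℂ f x) :
    DifferentiableAt ℂ (fun v => canDet (f v)) x := by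
  unfold canDet
  simp only [Matrix.det_apply, canMat, Matrix.of_apply]
  refine DifferentiableAt.fun_sum fun σ _ => ?_
  refine DifferentiableAt.const_smul ?_ _
  refine DifferentiableAt.fun_finsetProd fun i _ => ?_
  exact elem_differentiableAt hf _ _

theorem canInv_lim {n : ℕ} {α : Type*} {l : Filter α} {T : α → T2 n} {T0 : T2 n} {f : α → Mat n}
    {x : Mat n} (h0 : canDet T0 ≠ 0) (hT : Tendsto T l (𝓝 T0)) (hf : Tendsto f l (𝓝 x)) :
    Tendsto (fun a => canInv (T a) (f a)) l (𝓝 (canInv T0 x)) := by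
  have hdet : Tendsto (fun a => (canDet (T a))⁻¹) l (𝓝 (canDet T0)⁻¹) :=
    ((canDet_continuous.tendsto _).comp hT).inv₀ h0
  have hadj : Tendsto (fun a => (canMat (T a)).adjugate) l (𝓝 (canMat T0).adjugate) :=
    ((canMat_continuous.matrix_adjugate).tendsto _).comp hT
  have hc : Continuous fun p : T2 n × Mat n =>
      (Matrix.of fun k l => (p.1 *ᵥ fun q => p.2 q.1 q.2) (k, l) : Mat n) := by
    refine continuous_matrix fun k l => ?_
    simp only [Matrix.of_apply, Matrix.mulVec, dotProduct]
    refine continuous_finsetSum _ fun i _ => ?_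
    exact (continuous_fst.matrix_elem _ _).mul (continuous_snd.matrix_elem _ _)
  have hI : Tendsto (fun a => (canMat (T a))⁻¹) l (𝓝 (canMat T0)⁻¹) := by
    simp only [Matrix.inv_def, Ring.inverse_eq_inv']
    exact hdet.smul hadj
  have h2 : Tendsto (fun a => ((canMat (T a))⁻¹, f a)) l (𝓝 ((canMat T0)⁻¹, x)) :=
    hI.prodMk_nhds hf
  have h3 := (hc.tendsto _).comp h2
  exact h3

/-! ### The contradiction when there is no pole on the diagonal -/

theorem caseB {n : ℕ} (hn : 2 ≤ n) (s lam : ℂ → T2 n) (s0 : T2 n)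
    (hs : ∀ u, u ≠ 0 → ContinuousAt s u)
    (hd : Dense {u : ℂ | u ≠ 0 ∧ canDet (s u) ≠ 0})
    (hlim : Tendsto (fun v => s v - v⁻¹ • 1) (𝓝[≠] 0) (𝓝 s0))
    (hrel : ∀ u v, u ≠ 0 → v ≠ 0 → u + v ≠ 0 → ∀ X Y : Mat n,
      canMap (s (u + v)) (Y * canMap (lam u) X + canMap (lam v) Y * X) =
        canMap (s v) Y * canMap (s u) X) : False := by
  obtain ⟨N, hN⟩ : ∃ N, N = {u : ℂ | u ≠ 0 ∧ canDet (s u) ≠ 0} := ⟨_, rfl⟩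
  rw [← hN] at hd
  have hNmem : ∀ {u}, u ∈ N → u ≠ 0 ∧ canDet (s u) ≠ 0 := by
    intro u hu; rw [hN] at hu; exact hu
  have hNnhds : ∀ {u}, u ∈ N → N ∈ 𝓝 u := by
    intro u hu
    obtain ⟨h1, h2⟩ := hNmem hu
    have hc : Tendsto (fun u => canDet (s u)) (𝓝 u) (𝓝 (canDet (s u))) :=
      (canDet_continuous.tendsto _).comp (hs u h1)
    filter_upwards [hc.eventually_ne h2, eventually_ne_nhds h1] with w hw1 hw2
    rw [hN]
    exact ⟨hw2, hw1⟩
  have hNo : IsOpen N := isOpen_iff_mem_nhds.mpr fun u hu => hNnhds hu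
  obtain ⟨D, hD⟩ : ∃ D : ℂ → Mat n →ₗ[ℂ] Mat n, ∀ u, D u = canInv (s u) := ⟨_, fun _ => rfl⟩
  obtain ⟨H, hH⟩ : ∃ H : ℂ → Mat n →ₗ[ℂ] Mat n, ∀ u, H u = canL (lam u) ∘ₗ D u :=
    ⟨_, fun _ => rfl⟩
  have hDs : ∀ {u}, u ∈ N → ∀ X, D u (canMap (s u) X) = X := by
    intro u hu X; rw [hD]; exact canInv_left (hNmem hu).2 X
  have hmul : ∀ {u v}, u ∈ N → v ∈ N → u + v ∈ N → ∀ a b,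
      D (u + v) (a * b) = D v a * H u b + H v a * D u b := by
    intro u v hu hv huv a b
    have h := hrel u v (hNmem hu).1 (hNmem hv).1 (hNmem huv).1 (D u b) (D v a)
    rw [hD v, hD u, canInv_right (hNmem hu).2, canInv_right (hNmem hv).2] at h
    rw [← h, hDs huv, hH, hH, hD v, hD u]
    rfl
  have hDlim : ∀ {α : Type} {l : Filter α} {w : α → ℂ} {f : α → Mat n} {v a}, v ∈ N →
      Tendsto w l (𝓝 v) → Tendsto f l (𝓝 a) →
      Tendsto (fun i => D (w i) (f i)) l (𝓝 (D v a)) := by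
    intro α l w f v a hv hw hf
    simp only [hD]
    exact canInv_lim (hNmem hv).2 ((hs v (hNmem hv).1).tendsto.comp hw) hf
  -- choice of a base point
  obtain ⟨v0, hv0, hv0'⟩ : ∃ v0, v0 ∈ N ∧ -v0 ∈ N := by
    have h2 : Dense ((Homeomorph.neg ℂ) ⁻¹' N) := hd.preimage (Homeomorph.neg ℂ).isOpenMap
    obtain ⟨x, hx⟩ := (hd.inter_of_isOpen_left h2 hNo).nonempty
    exact ⟨x, hx.1, hx.2⟩
  obtain ⟨p, hp, hpv⟩ : ∃ p, p ∈ N ∧ p + v0 ∈ N := by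
    have h2 : Dense ((Homeomorph.addRight v0) ⁻¹' N) :=
      hd.preimage (Homeomorph.addRight v0).isOpenMap
    obtain ⟨x, hx⟩ := (hd.inter_of_isOpen_left h2 hNo).nonempty
    exact ⟨x, hx.1, hx.2⟩
  have hHeq : ∀ {q w}, q ∈ N → w ∈ N → q + w ∈ N → ∀ a,
      H w a = D (q + w) (a * canMap (s q) 1) - D w a * H q (canMap (s q) 1) := by
    intro q w hq hw hqw a
    rw [hmul hq hw hqw, hDs hq, mul_one]
    abel
  have hHlim : ∀ {α : Type} {l : Filter α} {w : α → ℂ} {f : α → Mat n} {a},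
      Tendsto w l (𝓝 v0) → Tendsto f l (𝓝 a) →
      Tendsto (fun i => H (w i) (f i)) l (𝓝 (H v0 a)) := by
    intro α l w f a hw hf
    rw [hHeq hp hv0 hpv a]
    have hpw : Tendsto (fun i => p + w i) l (𝓝 (p + v0)) := hw.const_add p
    refine ((hDlim hpv hpw (hf.mul tendsto_const_nhds)).sub
      ((hDlim hv0 hw hf).mul tendsto_const_nhds)).congr' ?_
    filter_upwards [hw (hNnhds hv0), hpw (hNnhds hpv)] with i h1 h2
    exact (hHeq hp h1 h2 (f i)).symm
  -- the limits at zero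
  obtain ⟨D0, hD0⟩ : ∃ D0 : Mat n →ₗ[ℂ] Mat n, ∀ a,
      D0 a = D v0 a * H (-v0) 1 + H v0 a * D (-v0) 1 :=
    ⟨LinearMap.mulRight ℂ (H (-v0) 1) ∘ₗ D v0 + LinearMap.mulRight ℂ (D (-v0) 1) ∘ₗ H v0,
      fun a => rfl⟩
  have hD0lim : ∀ {α : Type} {l : Filter α} {w : α → ℂ} {f : α → Mat n} {a},
      Tendsto w l (𝓝 0) → (∀ᶠ i in l, w i ∈ N) → Tendsto f l (𝓝 a) →
      Tendsto (fun i => D (w i) (f i)) l (𝓝 (D0 a)) := by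
    intro α l w f a hw hwN hf
    rw [hD0]
    have hwv : Tendsto (fun i => w i + v0) l (𝓝 v0) := by
      simpa using hw.add_const v0
    refine (((hDlim hv0 hwv hf).mul tendsto_const_nhds).add
      ((hHlim hwv hf).mul tendsto_const_nhds)).congr' ?_
    filter_upwards [hwN, hwv (hNnhds hv0)] with i h1 h2
    have h3 := hmul hv0' h2 (by simpa using h1) (f i) 1
    rw [← h3]
    simp
  obtain ⟨H0, hH0⟩ : ∃ H0 : Mat n →ₗ[ℂ] Mat n, ∀ a,
      H0 a = D v0 (a * canMap (s v0) 1) - D0 a * H v0 (canMap (s v0) 1) :=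
    ⟨D v0 ∘ₗ LinearMap.mulRight ℂ (canMap (s v0) 1) -
      LinearMap.mulRight ℂ (H v0 (canMap (s v0) 1)) ∘ₗ D0, fun a => rfl⟩
  have hH0lim : ∀ {α : Type} {l : Filter α} {w : α → ℂ} {f : α → Mat n} {a},
      Tendsto w l (𝓝 0) → (∀ᶠ i in l, w i ∈ N) → Tendsto f l (𝓝 a) →
      Tendsto (fun i => H (w i) (f i)) l (𝓝 (H0 a)) := by
    intro α l w f a hw hwN hf
    rw [hH0]
    have hwv : Tendsto (fun i => v0 + w i) l (𝓝 v0) := by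
      simpa using hw.const_add v0
    refine ((hDlim hv0 hwv (hf.mul tendsto_const_nhds)).sub
      ((hD0lim hw hwN hf).mul tendsto_const_nhds)).congr' ?_
    filter_upwards [hwN, hwv (hNnhds hv0)] with i h1 h2
    exact (hHeq hv0 h1 h2 (f i)).symm
  have hrel0 : ∀ a b, D0 (a * b) = D0 a * H0 b + H0 a * D0 b := by
    intro a b
    have h2 : Dense ((Homeomorph.mulLeft₀ (2 : ℂ) two_ne_zero) ⁻¹' N) :=
      hd.preimage (Homeomorph.mulLeft₀ (2 : ℂ) two_ne_zero).isOpenMap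
    have h3 := hd.inter_of_isOpen_left h2 hNo
    have hne : (𝓝[N ∩ ((Homeomorph.mulLeft₀ (2 : ℂ) two_ne_zero) ⁻¹' N)] (0 : ℂ)).NeBot :=
      mem_closure_iff_nhdsWithin_neBot.mp (h3 0)
    have hid : Tendsto (fun t : ℂ => t)
        (𝓝[N ∩ ((Homeomorph.mulLeft₀ (2 : ℂ) two_ne_zero) ⁻¹' N)] (0 : ℂ)) (𝓝 0) :=
      tendsto_id.mono_left nhdsWithin_le_nhds
    have hin : ∀ᶠ t in (𝓝[N ∩ ((Homeomorph.mulLeft₀ (2 : ℂ) two_ne_zero) ⁻¹' N)] (0 : ℂ)),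
        t ∈ N := by
      filter_upwards [self_mem_nhdsWithin] with t ht using ht.1
    have hin2 : ∀ᶠ t in (𝓝[N ∩ ((Homeomorph.mulLeft₀ (2 : ℂ) two_ne_zero) ⁻¹' N)] (0 : ℂ)),
        t + t ∈ N := by
      filter_upwards [self_mem_nhdsWithin] with t ht
      have := ht.2
      rw [← two_mul]
      exact this
    have l1 := hD0lim (by simpa using hid.add hid) hin2 (tendsto_const_nhds (x := a * b))
    have la := hD0lim hid hin (tendsto_const_nhds (x := a))
    have lb := hD0lim hid hin (tendsto_const_nhds (x := b))
    have ka := hH0lim hid hin (tendsto_const_nhds (x := a))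
    have kb := hH0lim hid hin (tendsto_const_nhds (x := b))
    refine tendsto_nhds_unique l1 (((la.mul kb).add (ka.mul lb)).congr' ?_)
    filter_upwards [hin, hin2] with t h1 h2
    exact (hmul h1 h1 h2 a b).symm
  have hneN : (𝓝[N] (0 : ℂ)).NeBot := mem_closure_iff_nhdsWithin_neBot.mp (hd 0)
  have hidN : Tendsto (fun t : ℂ => t) (𝓝[N] (0 : ℂ)) (𝓝 0) :=
    tendsto_id.mono_left nhdsWithin_le_nhds
  have hle : 𝓝[N] (0 : ℂ) ≤ 𝓝[≠] 0 := nhdsWithin_mono _ fun u hu => (hNmem hu).1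
  have hlim' : ∀ X : Mat n, Tendsto (fun u => canMap (s u - u⁻¹ • 1) X) (𝓝[N] 0)
      (𝓝 (canMap s0 X)) := fun X => canMap_lim (hlim.mono_left hle) tendsto_const_nhds
  have hexp : ∀ u X, canMap (s u - u⁻¹ • 1) X = canMap (s u) X - u⁻¹ • X.trace • 1 := by
    intro u X
    rw [canMap_sub_left, canMap_smul_left, canMap_one]
  have hin : ∀ᶠ t in 𝓝[N] (0 : ℂ), t ∈ N := self_mem_nhdsWithin
  have hX0 : ∀ X : Mat n, X.trace = 0 → D0 (canMap s0 X) = X := by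
    intro X hX
    have h1 := hD0lim hidN hin (hlim' X)
    refine tendsto_nhds_unique h1 (tendsto_const_nhds.congr' ?_)
    filter_upwards [hin] with u hu
    rw [hexp, hX, zero_smul, smul_zero, sub_zero, hDs hu]
  have h10 : D0 1 = 0 := by
    have hn0 : (n : ℂ) ≠ 0 := by
      have : n ≠ 0 := by omega
      exact_mod_cast this
    have h1 : Tendsto (fun u : ℂ => u • canMap (s u - u⁻¹ • 1) (1 : Mat n) + (n : ℂ) • (1 : Mat n))
        (𝓝[N] 0) (𝓝 ((0 : ℂ) • canMap s0 1 + (n : ℂ) • (1 : Mat n))) :=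
      (hidN.smul (hlim' 1)).add tendsto_const_nhds
    have h2 := hD0lim hidN hin h1
    have h3 : Tendsto (fun u : ℂ => u • (1 : Mat n)) (𝓝[N] 0) (𝓝 ((0 : ℂ) • (1 : Mat n))) :=
      hidN.smul tendsto_const_nhds
    have h4 := tendsto_nhds_unique h2 (h3.congr' (by
      filter_upwards [hin] with u hu
      have hu0 := (hNmem hu).1
      rw [hexp, smul_sub, smul_smul, mul_inv_cancel₀ hu0, one_smul, Matrix.trace_one,
        Fintype.card_fin, sub_add_cancel, map_smul, hDs hu]))
    rw [zero_smul, zero_smul, zero_add, map_smul] at h4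
    exact (smul_eq_zero.mp h4).resolve_left hn0
  exact alg_contra hn D0 H0 hrel0 h10 fun X hX => ⟨canMap s0 X, hX0 X hX⟩

/-! ### Complex-analytic tools -/

theorem dense_nonzero {f : ℂ → ℂ} {p w : ℂ} (hf : ∀ z, z ≠ p → DifferentiableAt ℂ f z)
    (hw : w ≠ p) (hfw : f w ≠ 0) : Dense {u : ℂ | u ≠ p ∧ f u ≠ 0} := by
  have hpre : IsPreconnected ({p}ᶜ : Set ℂ) := by
    apply IsConnected.isPreconnected
    apply isConnected_compl_singleton_of_one_lt_rank
    rw [Complex.rank_real_complex]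
    norm_num
  have han : AnalyticOnNhd ℂ f ({p}ᶜ : Set ℂ) := by
    have : DifferentiableOn ℂ f ({p}ᶜ : Set ℂ) := fun z hz => (hf z hz).differentiableWithinAt
    exact this.analyticOnNhd isOpen_compl_singleton
  intro x
  by_contra hx
  rw [mem_closure_iff_frequently, not_frequently] at hx
  have hzero : ∃ z0, z0 ≠ p ∧ f =ᶠ[𝓝 z0] 0 := by
    by_cases hxp : x = p
    · subst hxp
      obtain ⟨V, hV1, hV2, hV3⟩ := _root_.eventually_nhds_iff.mp hx
      have : (𝓝[≠] x).NeBot := inferInstance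
      obtain ⟨z0, hz0⟩ := this.nonempty_of_mem (inter_mem
        (mem_nhdsWithin_of_mem_nhds (hV2.mem_nhds hV3) : V ∈ 𝓝[≠] x) self_mem_nhdsWithin)
      refine ⟨z0, hz0.2, ?_⟩
      filter_upwards [hV2.mem_nhds hz0.1, isOpen_compl_singleton.mem_nhds hz0.2] with u h1 h2
      by_contra h3
      exact hV1 u h1 ⟨h2, h3⟩
    · refine ⟨x, hxp, ?_⟩
      filter_upwards [hx, eventually_ne_nhds hxp] with u h1 h2
      by_contra h3
      exact h1 ⟨h2, h3⟩
  obtain ⟨z0, hz0, hz⟩ := hzero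
  exact hfw (han.eqOn_zero_of_preconnected_of_eventuallyEq_zero hpre hz0 hz hw)

theorem holo_limit {E : Type*} [NormedAddCommGroup E] [NormedSpace ℂ E] [CompleteSpace E]
    (F : ℂ → ℂ → E) {U : Set ℂ} (hU : IsOpen U)
    (hF : ∀ z ∈ U, Differentiable ℂ (fun v => F v z))
    (hz : ∀ v, v ≠ 0 → DifferentiableOn ℂ (F v) U)
    (hc : ContinuousOn (fun p : ℂ × ℂ => F p.1 p.2) (Metric.sphere 0 1 ×ˢ U)) :
    DifferentiableOn ℂ (F 0) U := by
  refine TendstoLocallyUniformlyOn.differentiableOn (φ := 𝓝[≠] (0 : ℂ)) (F := F) ?_ ?_ hU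
  · rw [tendstoLocallyUniformlyOn_iff_forall_isCompact hU]
    intro K hKU hK
    obtain ⟨M, hM⟩ := ((isCompact_sphere (0 : ℂ) 1).prod hK).exists_bound_of_continuousOn
      (hc.mono (prod_mono subset_rfl hKU))
    have hb : ∀ z ∈ K, ∀ v ∈ Metric.closedBall (0 : ℂ) 1, ‖F v z‖ ≤ M := by
      intro z hzK v hv
      refine Complex.norm_le_of_forall_mem_frontier_norm_le (U := Metric.ball (0 : ℂ) 1)
        Metric.isBounded_ball (f := fun v => F v z) (hF z (hKU hzK)).diffContOnCl ?_ ?_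
      · intro w hw
        rw [frontier_ball _ one_ne_zero] at hw
        exact hM (w, z) ⟨hw, hzK⟩
      · rw [closure_ball _ one_ne_zero]
        exact hv
    rw [Metric.tendstoUniformlyOn_iff]
    intro ε hε
    have hlin : ∀ z ∈ K, ∀ v ∈ Metric.ball (0 : ℂ) 1, dist (F v z) (F 0 z) ≤ (2 * M) * ‖v‖ := by
      intro z hzK v hv
      have h := Complex.dist_le_div_mul_dist_of_mapsTo_ball (f := fun v => F v z) (c := 0)
        (R₁ := 1) (R₂ := 2 * M) (z := v) (hF z (hKU hzK)).differentiableOn ?_ hv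
      · simpa using h
      · intro w hw
        have h1 := hb z hzK w (Metric.ball_subset_closedBall hw)
        have h2 := hb z hzK 0 (Metric.mem_closedBall_self zero_le_one)
        rw [Metric.mem_closedBall, dist_eq_norm]
        calc ‖F w z - F 0 z‖ ≤ ‖F w z‖ + ‖F 0 z‖ := norm_sub_le _ _
          _ ≤ 2 * M := by linarith
    have hsm : ∀ᶠ v : ℂ in 𝓝[≠] 0, 2 * M * ‖v‖ < ε := by
      have : Tendsto (fun v : ℂ => 2 * M * ‖v‖) (𝓝 0) (𝓝 (2 * M * ‖(0 : ℂ)‖)) :=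
        (continuous_const.mul continuous_norm).tendsto 0
      simp only [norm_zero, mul_zero] at this
      exact (this.mono_left nhdsWithin_le_nhds).eventually_lt_const hε
    filter_upwards [hsm, mem_nhdsWithin_of_mem_nhds (Metric.ball_mem_nhds (0 : ℂ) one_pos)]
      with v h1 h2 z hzK
    rw [dist_comm]
    exact (hlin z hzK v h2).trans_lt h1
  · filter_upwards [self_mem_nhdsWithin] with v hv using hz v hv

theorem mero_pair {E : Type*} [NormedAddCommGroup E] [NormedSpace ℂ E] {f g : ℂ → E} {y : ℂ}
    (hf : MeromorphicAt f y) (hg : MeromorphicAt g y)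
    (hno : ¬ ∃ c, Tendsto f (𝓝[≠] y) (𝓝 c)) :
    ∃ k : ℕ, 1 ≤ k ∧ ∃ ρ ρ' : E, Tendsto (fun z => (z - y) ^ k • f z) (𝓝[≠] y) (𝓝 ρ) ∧
      Tendsto (fun z => (z - y) ^ k • g z) (𝓝[≠] y) (𝓝 ρ') ∧ ¬ (ρ = 0 ∧ ρ' = 0) := by
  classical
  have hid : ∀ k : ℕ, MeromorphicAt (fun z : ℂ => (z - y) ^ k) y := fun k => by fun_prop
  have hmer : ∀ {h : ℂ → E}, MeromorphicAt h y → ∀ k : ℕ,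
      MeromorphicAt (fun z => (z - y) ^ k • h z) y := fun {h} hh k => (hid k).smul hh
  have hmono : ∀ {h : ℂ → E} {k m : ℕ}, k ≤ m →
      (∃ c, Tendsto (fun z => (z - y) ^ k • h z) (𝓝[≠] y) (𝓝 c)) →
      ∃ c, Tendsto (fun z => (z - y) ^ m • h z) (𝓝[≠] y) (𝓝 c) := by
    rintro h k m hkm ⟨c, hc⟩
    obtain ⟨j, rfl⟩ := Nat.exists_eq_add_of_le hkm
    have h1 : Tendsto (fun z : ℂ => (z - y) ^ j) (𝓝[≠] y) (𝓝 ((y - y) ^ j)) :=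
      (((continuous_id.sub continuous_const).pow j).tendsto y).mono_left nhdsWithin_le_nhds
    refine ⟨_, (h1.smul hc).congr fun z => ?_⟩
    rw [smul_smul, pow_add, mul_comm]
  have hex : ∃ k : ℕ, (∃ c, Tendsto (fun z => (z - y) ^ k • f z) (𝓝[≠] y) (𝓝 c)) ∧
      ∃ c, Tendsto (fun z => (z - y) ^ k • g z) (𝓝[≠] y) (𝓝 c) := by
    obtain ⟨k1, h1⟩ := hf
    obtain ⟨k2, h2⟩ := hg
    exact ⟨max k1 k2,
      hmono (le_max_left _ _) ⟨_, h1.continuousAt.tendsto.mono_left nhdsWithin_le_nhds⟩,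
      hmono (le_max_right _ _) ⟨_, h2.continuousAt.tendsto.mono_left nhdsWithin_le_nhds⟩⟩
  have hk := Nat.find_spec hex
  obtain ⟨⟨ρ, hρ⟩, ρ', hρ'⟩ := hk
  have hk1 : 1 ≤ Nat.find hex := by
    rw [Nat.one_le_iff_ne_zero]
    intro h0
    rw [h0] at hρ
    simp only [pow_zero, one_smul] at hρ
    exact hno ⟨ρ, hρ⟩
  refine ⟨Nat.find hex, hk1, ρ, ρ', hρ, hρ', ?_⟩
  rintro ⟨rfl, rfl⟩
  obtain ⟨m, hm⟩ := Nat.exists_eq_add_of_le' hk1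
  have key : ∀ {h : ℂ → E}, MeromorphicAt h y →
      Tendsto (fun z => (z - y) ^ (m + 1) • h z) (𝓝[≠] y) (𝓝 0) →
      ∃ c, Tendsto (fun z => (z - y) ^ m • h z) (𝓝[≠] y) (𝓝 c) := by
    intro h hh h0
    rw [tendsto_nhds_iff_meromorphicOrderAt_nonneg (hmer hh m)]
    have h1 := (tendsto_zero_iff_meromorphicOrderAt_pos (hmer hh (m + 1))).mp h0
    have h2 : (fun z => (z - y) ^ (m + 1) • h z) =
        (fun z : ℂ => z - y) • (fun z => (z - y) ^ m • h z) := by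
      ext z
      simp only [Pi.smul_apply', smul_smul]
      rw [pow_succ']
    have h3 : MeromorphicAt (fun z : ℂ => z - y) y := by fun_prop
    rw [h2, meromorphicOrderAt_smul h3 (hmer hh m), meromorphicOrderAt_id_sub_const] at h1
    cases h4 : meromorphicOrderAt (fun z => (z - y) ^ m • h z) y with
    | top => exact le_top
    | coe q =>
      rw [h4] at h1
      have h5 : (0 : ℤ) < 1 + q := by exact_mod_cast h1
      have h6 : (0 : ℤ) ≤ q := by omega
      exact_mod_cast h6
  rw [hm] at hρ hρ'
  have hlt : m < Nat.find hex := by omega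
  exact Nat.find_min hex hlt ⟨key hf hρ, key hg hρ'⟩

theorem rc0_differentiableAt {n : ℕ} {r : ℂ → ℂ → ℂ → T2 n} {rc : ℕ → ℂ → ℂ → T2 n}
    (hH : IsHolomorphicOnDomain r) (hF : HasLaurentForm r rc) {y z : ℂ} (hyz : z ≠ y) :
    DifferentiableAt ℂ (fun z => rc 0 y z) z := by
  have h := holo_limit (fun v z => regPart r rc y z v) (U := ({y}ᶜ : Set ℂ))
    isOpen_compl_singleton ?_ ?_ ?_
  · have h2 := (h z hyz).differentiableAt (isOpen_compl_singleton.mem_nhds hyz)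
    have h3 : (fun z => regPart r rc y z 0) = fun z => rc 0 y z := by
      ext1 z; simp [regPart]
    rwa [h3] at h2
  · intro x hx v
    have hyx : y ≠ x := fun e => hx e.symm
    by_cases hv : v = 0
    · subst hv
      exact (regPart_analyticAt hF hyx).differentiableAt
    · have h1 : DifferentiableAt ℂ (fun v => r v y x - v⁻¹ • 1) v :=
        (r_cont_v hH hv hyx).sub ((differentiableAt_inv hv).smul_const (1 : T2 n))
      refine h1.congr_of_eventuallyEq ?_
      filter_upwards [eventually_ne_nhds hv] with w hw
      simp [regPart, hw]
  · intro v hv x hx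
    have hyx : y ≠ x := fun e => hx e.symm
    have h1 : DifferentiableAt ℂ (fun x => r v y x - v⁻¹ • 1) x :=
      (r_cont_3 hH hv hyx).sub_const _
    have h2 : (fun x => regPart r rc y x v) = fun x => r v y x - v⁻¹ • 1 := by
      ext1 x; simp [regPart, hv]
    rw [h2]
    exact h1.differentiableWithinAt
  · rintro ⟨v, x⟩ ⟨hv, hx⟩
    have hyx : y ≠ x := fun e => hx e.symm
    have hv0 : v ≠ 0 := by
      rintro rfl
      simp at hv
    have h1 : ContinuousAt (fun p : ℂ × ℂ => r p.1 y p.2) (v, x) :=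
      ContinuousAt.comp (g := fun p : ℂ × ℂ × ℂ => r p.1 p.2.1 p.2.2)
        (f := fun p : ℂ × ℂ => (p.1, y, p.2)) (r_continuousAt hH hv0 hyx).continuousAt
        (by fun_prop)
    have h2 : ContinuousAt (fun p : ℂ × ℂ => p.1⁻¹ • (1 : T2 n)) (v, x) :=
      (continuousAt_fst.inv₀ hv0).smul continuousAt_const
    have h3 : ContinuousAt (fun p : ℂ × ℂ => r p.1 y p.2 - p.1⁻¹ • (1 : T2 n)) (v, x) := h1.sub h2
    have h4 : (fun p : ℂ × ℂ => r p.1 y p.2 - p.1⁻¹ • (1 : T2 n)) =ᶠ[𝓝 (v, x)]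
        fun p => regPart r rc y p.2 p.1 := by
      filter_upwards [continuousAt_fst.eventually_ne hv0] with p hp
      simp [regPart, hp]
    exact (h3.congr h4).continuousWithinAt

/-! ### Non-degeneracy -/

theorem eventually_ne_pair {y y₃ : ℂ} (h : y ≠ y₃) :
    ∀ᶠ z in 𝓝[≠] y, z ≠ y ∧ z ≠ y₃ := by
  filter_upwards [self_mem_nhdsWithin, mem_nhdsWithin_of_mem_nhds (eventually_ne_nhds h)]
    with z h1 h2
  exact ⟨h1, h2⟩

theorem pair_lim {n : ℕ} {r : ℂ → ℂ → ℂ → T2 n} (hA : IsAYBESolution r)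
    (hU : IsUnitarySolution r) (hH : IsHolomorphicOnDomain r) {u v y y₃ : ℂ}
    (hu : u ≠ 0) (hv : v ≠ 0) (huv : u + v ≠ 0) (hy : y ≠ y₃)
    {φ : ℂ → ℂ} {φ0 : ℂ} {a b : T2 n} (hφ : Tendsto φ (𝓝[≠] y) (𝓝 φ0))
    (ha : Tendsto (fun z => φ z • r u y z) (𝓝[≠] y) (𝓝 a))
    (hb : Tendsto (fun z => φ z • r v z y) (𝓝[≠] y) (𝓝 b)) (X Y : Mat n) :
    canMap (r (u + v) y y₃) (Y * canMap a X + canMap b Y * X) =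
        φ0 • (canMap (r v y y₃) Y * canMap (r u y y₃) X) ∧
    canMap (r (u + v) y y₃) (Y * canMap b X + canMap a Y * X) =
        φ0 • (canMap (r u y y₃) Y * canMap (r v y y₃) X) := by
  have hr : ∀ {w}, w ≠ 0 → Tendsto (fun z => r w z y₃) (𝓝[≠] y) (𝓝 (r w y y₃)) := fun {w} hw =>
    (r_cont_2 hH hw hy).continuousAt.tendsto.mono_left nhdsWithin_le_nhds
  have cst : ∀ Z : Mat n, Tendsto (fun _ : ℂ => Z) (𝓝[≠] y) (𝓝 Z) := fun Z => tendsto_const_nhds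
  have cst2 : ∀ Z : T2 n, Tendsto (fun _ : ℂ => Z) (𝓝[≠] y) (𝓝 Z) := fun Z => tendsto_const_nhds
  constructor
  · have h1 := (canMap_lim (hr huv) ((cst Y).mul (canMap_lim ha (cst X)))).add
      (canMap_lim (cst2 (r (u + v) y y₃)) ((canMap_lim hb (cst Y)).mul (cst X)))
    have h2 := hφ.smul ((canMap_lim (hr hv) (cst Y)).mul (cst (canMap (r u y y₃) X)))
    rw [canMap_add_right]
    refine tendsto_nhds_unique (h1.congr' ?_) h2
    filter_upwards [eventually_ne_pair hy] with z hz
    rw [← aybe_op' hA hU hu hv huv hz.1.symm hy hz.2 X Y, smul_add]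
    simp only [canMap_smul_left, canMap_smul_right, Matrix.mul_smul, Matrix.smul_mul]
  · have h1 := (canMap_lim (cst2 (r (u + v) y y₃)) ((cst Y).mul (canMap_lim hb (cst X)))).add
      (canMap_lim (hr huv) ((canMap_lim ha (cst Y)).mul (cst X)))
    have h2 := hφ.smul ((cst (canMap (r u y y₃) Y)).mul (canMap_lim (hr hv) (cst X)))
    rw [canMap_add_right]
    refine tendsto_nhds_unique (h1.congr' ?_) h2
    filter_upwards [eventually_ne_pair hy] with z hz
    have h3 := aybe_op' hA hU hv hu (by rwa [add_comm]) hz.1 hz.2 hy X Y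
    rw [add_comm v u] at h3
    rw [← h3, smul_add]
    simp only [canMap_smul_left, canMap_smul_right, Matrix.mul_smul, Matrix.smul_mul]

theorem lim_flip {n : ℕ} {r : ℂ → ℂ → ℂ → T2 n}
    (hU : IsUnitarySolution r) {v y : ℂ} (hv : v ≠ 0) {φ : ℂ → ℂ} {a : T2 n}
    (ha : Tendsto (fun z => φ z • r (-v) y z) (𝓝[≠] y) (𝓝 a)) :
    Tendsto (fun z => φ z • r v z y) (𝓝[≠] y) (𝓝 (-tflip a)) := by
  have h : Tendsto (fun z => -tflip (φ z • r (-v) y z)) (𝓝[≠] y) (𝓝 (-tflip a)) := by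
    have := ((tflipL n).continuous.tendsto a).comp ha
    exact this.neg
  refine h.congr' ?_
  filter_upwards [self_mem_nhdsWithin] with z hz
  have h1 := hU v z y hv hz
  have h2 : tflip (φ z • r (-v) y z) = φ z • tflip (r (-v) y z) := by
    ext p q; simp [tflip]
  rw [h2, h1]
  simp

theorem no_caseB {n : ℕ} (hn : 2 ≤ n) {r : ℂ → ℂ → ℂ → T2 n} {rc : ℕ → ℂ → ℂ → T2 n}
    (hA : IsAYBESolution r) (hU : IsUnitarySolution r) (hH : IsHolomorphicOnDomain r)
    (hF : HasLaurentForm r rc) {y y₃ : ℂ} (hy : y ≠ y₃)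
    (hd : Dense {u : ℂ | u ≠ 0 ∧ canDet (r u y y₃) ≠ 0})
    (hlimit : ∀ u, u ≠ 0 → ∃ c, Tendsto (fun z => r u y z) (𝓝[≠] y) (𝓝 c)) : False := by
  have hex : ∀ u, ∃ c, u ≠ 0 → Tendsto (fun z => r u y z) (𝓝[≠] y) (𝓝 c) := by
    intro u
    by_cases hu : u = 0
    · exact ⟨0, fun h => absurd hu h⟩
    · obtain ⟨c, hc⟩ := hlimit u hu
      exact ⟨c, fun _ => hc⟩
  choose α hα using hex
  have ha : ∀ u, u ≠ 0 → Tendsto (fun z => (1 : ℂ) • r u y z) (𝓝[≠] y) (𝓝 (α u)) := by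
    intro u hu
    simpa using hα u hu
  have hb : ∀ u, u ≠ 0 → Tendsto (fun z => (1 : ℂ) • r u z y) (𝓝[≠] y)
      (𝓝 (-tflip (α (-u)))) := fun u hu =>
    lim_flip (φ := fun _ => 1) hU hu (ha (-u) (neg_ne_zero.mpr hu))
  refine caseB hn (fun u => r u y y₃) (fun u => (1 / 2 : ℂ) • (α u + -tflip (α (-u)))) (rc 0 y y₃)
    (fun u hu => (r_cont_v hH hu hy).continuousAt) hd (tendsto_rc0 hF hy) ?_
  intro u v hu hv huv X Y
  have e1 := (pair_lim hA hU hH hu hv huv hy (φ := fun _ => 1) tendsto_const_nhds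
    (ha u hu) (hb v hv) X Y).1
  have e2 := (pair_lim hA hU hH hv hu (by rwa [add_comm]) hy (φ := fun _ => 1) tendsto_const_nhds
    (ha v hv) (hb u hu) X Y).2
  rw [add_comm v u] at e2
  have e3 : Y * canMap ((1 / 2 : ℂ) • (α u + -tflip (α (-u)))) X +
      canMap ((1 / 2 : ℂ) • (α v + -tflip (α (-v)))) Y * X =
      (1 / 2 : ℂ) • ((Y * canMap (α u) X + canMap (-tflip (α (-v))) Y * X) +
        (Y * canMap (-tflip (α (-u))) X + canMap (α v) Y * X)) := by
    simp only [canMap_smul_left, canMap_add_left, Matrix.mul_smul, Matrix.smul_mul, mul_add,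
      add_mul, smul_add]
    abel
  change canMap (r (u + v) y y₃) _ = canMap (r v y y₃) Y * canMap (r u y y₃) X
  rw [e3, canMap_smul_right, canMap_add_right, e1, e2, one_smul, ← two_smul ℂ, smul_smul]
  norm_num

theorem canMap_injective {n : ℕ} {t : T2 n} (h : canDet t ≠ 0) {Z : Mat n}
    (hZ : canMap t Z = 0) : Z = 0 := by
  have := canInv_left h Z
  rw [hZ, map_zero] at this
  exact this.symm

theorem tendsto_of_canMap {n : ℕ} {α : Type*} {l : Filter α} [l.NeBot] {G : α → T2 n}
    {L : Mat n → Mat n} (h : ∀ Z, Tendsto (fun a => canMap (G a) Z) l (𝓝 (L Z))) :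
    ∃ G0 : T2 n, Tendsto G l (𝓝 G0) ∧ ∀ Z, canMap G0 Z = L Z := by
  have hent : ∀ (t : T2 n) (p q : Fin n × Fin n),
      t p q = canMap t (Matrix.single q.1 p.1 1) p.2 q.2 := by
    intro t p q
    simp only [canMap, Matrix.of_apply, Matrix.single_apply]
    rw [Finset.sum_eq_single p.1, Finset.sum_eq_single q.1]
    · simp
    · intro b _ hb
      simp [hb.symm]
    · simp
    · intro b _ hb
      simp [hb.symm]
    · simp
  have hG : Tendsto G l (𝓝 (Matrix.of fun p q => L (Matrix.single q.1 p.1 1) p.2 q.2)) := by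
    refine tendsto_pi_nhds.mpr fun p => tendsto_pi_nhds.mpr fun q => ?_
    have h1 := tendsto_pi_nhds.mp (tendsto_pi_nhds.mp (h (Matrix.single q.1 p.1 1)) p.2) q.2
    exact h1.congr fun a => (hent (G a) p q).symm
  exact ⟨_, hG, fun Z => tendsto_nhds_unique (canMap_lim hG tendsto_const_nhds) (h Z)⟩

theorem caseA {n : ℕ} (hn : 2 ≤ n) {r : ℂ → ℂ → ℂ → T2 n} {rc : ℕ → ℂ → ℂ → T2 n}
    (hA : IsAYBESolution r) (hU : IsUnitarySolution r) (hH : IsHolomorphicOnDomain r)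
    (hF : HasLaurentForm r rc) (hM : IsMeromorphicAlongDiagonal r) {y y₃ : ℂ} (hy : y ≠ y₃)
    (hd : Dense {u : ℂ | u ≠ 0 ∧ canDet (r u y y₃) ≠ 0}) {u₀ : ℂ} (hu₀ : u₀ ≠ 0)
    (hno : ¬ ∃ c, Tendsto (fun z => r u₀ y z) (𝓝[≠] y) (𝓝 c)) :
    ∃ z, z ≠ y ∧ canDet (prTensorPr (rc 0 y z) + 1) ≠ 0 := by
  obtain ⟨N, hN⟩ : ∃ N, N = {u : ℂ | u ≠ 0 ∧ canDet (r u y y₃) ≠ 0} := ⟨_, rfl⟩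
  rw [← hN] at hd
  have hNmem : ∀ {u}, u ∈ N → u ≠ 0 ∧ canDet (r u y y₃) ≠ 0 := by
    intro u hu; rw [hN] at hu; exact hu
  have hNo : IsOpen N := by
    refine isOpen_iff_mem_nhds.mpr fun u hu => ?_
    obtain ⟨h1, h2⟩ := hNmem hu
    have hc : Tendsto (fun u => canDet (r u y y₃)) (𝓝 u) (𝓝 (canDet (r u y y₃))) :=
      (canDet_continuous.tendsto _).comp (r_cont_v hH h1 hy).continuousAt
    filter_upwards [hc.eventually_ne h2, eventually_ne_nhds h1] with w hw1 hw2
    rw [hN]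
    exact ⟨hw2, hw1⟩
  obtain ⟨v, hv, huv⟩ : ∃ v, v ∈ N ∧ u₀ + v ∈ N := by
    have h2 : Dense ((Homeomorph.addLeft u₀) ⁻¹' N) :=
      hd.preimage (Homeomorph.addLeft u₀).isOpenMap
    obtain ⟨x, hx⟩ := (hd.inter_of_isOpen_left h2 hNo).nonempty
    exact ⟨x, hx.1, hx.2⟩
  have hv0 := (hNmem hv).1
  obtain ⟨k, hk, ρ, ρ', hρ, hρ', hne⟩ := mero_pair (hM u₀ hu₀ y)
    (hM (-v) (neg_ne_zero.mpr hv0) y) hno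
  have hφ : Tendsto (fun z : ℂ => (z - y) ^ k) (𝓝[≠] y) (𝓝 0) := by
    have h1 : Tendsto (fun z : ℂ => (z - y) ^ k) (𝓝[≠] y) (𝓝 ((y - y) ^ k)) :=
      (((continuous_id.sub continuous_const).pow k).tendsto y).mono_left nhdsWithin_le_nhds
    rwa [sub_self, zero_pow (by omega)] at h1
  have hβ := lim_flip (φ := fun z => (z - y) ^ k) hU hv0 hρ'
  obtain ⟨b, hb⟩ : ∃ b, b = -tflip ρ' := ⟨_, rfl⟩
  rw [← hb] at hβ
  have hrel : ∀ X Y, Y * canMap ρ X + canMap b Y * X = 0 ∧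
      Y * canMap b X + canMap ρ Y * X = 0 := by
    intro X Y
    have h := pair_lim hA hU hH hu₀ hv0 (hNmem huv).1 hy hφ hρ hβ X Y
    rw [zero_smul, zero_smul] at h
    exact ⟨canMap_injective (hNmem huv).2 h.1, canMap_injective (hNmem huv).2 h.2⟩
  obtain ⟨m, hm⟩ : ∃ m, m = canMap ρ 1 := ⟨_, rfl⟩
  have hbm : ∀ Y, canMap b Y = -(Y * m) := by
    intro Y
    have := (hrel 1 Y).1
    rw [← hm, mul_one] at this
    exact eq_neg_of_add_eq_zero_right this
  have ham : ∀ X, canMap ρ X = m * X := by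
    intro X
    have := (hrel X 1).1
    rw [hbm, one_mul, one_mul] at this
    rw [eq_neg_of_add_eq_zero_left this]
    simp
  have hcen : ∀ X, X * m = m * X := by
    intro X
    have := (hrel X 1).2
    rw [hbm, ham, one_mul, mul_one] at this
    rw [← sub_eq_zero, ← neg_eq_zero, ← this]
    abel
  obtain ⟨c, hc⟩ := scalar_of_commute_traceless hn m fun X _ => hcen X
  have hc0 : c ≠ 0 := by
    rintro rfl
    rw [zero_smul] at hc
    apply hne
    constructor
    · refine canMap_inj _ fun Z => ?_
      rw [ham, hc, zero_mul]
    · have : b = 0 := by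
        refine canMap_inj _ fun Z => ?_
        rw [hbm, hc, mul_zero, neg_zero]
      rw [this] at hb
      have h0 : tflip ρ' = 0 := neg_eq_zero.mp hb.symm
      ext p q
      have := congrFun (congrFun h0 (p.2, p.1)) (q.2, q.1)
      simpa [tflip] using this
  have hK : ∀ X : Mat n, X.trace = 0 →
      Tendsto (fun z => (z - y) ^ k • canMap (rc 0 y z) X) (𝓝[≠] y) (𝓝 (c • X)) := by
    intro X hX
    have hr : Tendsto (fun z => r v z y₃) (𝓝[≠] y) (𝓝 (r v y y₃)) :=
      (r_cont_2 hH hv0 hy).continuousAt.tendsto.mono_left nhdsWithin_le_nhds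
    have cst : ∀ Z : Mat n, Tendsto (fun _ : ℂ => Z) (𝓝[≠] y) (𝓝 Z) :=
      fun Z => tendsto_const_nhds
    have h1 : Tendsto (fun z => canMap (r v z y₃) ((z - y) ^ k • canMap (rc 0 y z) X)) (𝓝[≠] y)
        (𝓝 (canMap (r v y y₃) (c • X))) := by
      have h2 := (hφ.smul ((canMap_lim hr (cst 1)).mul (cst (canMap (rc 0 y y₃) X)))).sub
        (canMap_lim (tendsto_const_nhds (x := r v y y₃))
          ((canMap_lim hβ (cst 1)).mul (cst X)))
      rw [hbm, hc, zero_smul, zero_sub, ← canMap_neg_right] at h2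
      have e : -(-((1 : Mat n) * c • (1 : Mat n)) * X) = c • X := by simp
      rw [e] at h2
      refine h2.congr' ?_
      filter_upwards [eventually_ne_pair hy] with z hz
      have h3 := aybe_zero hA hU hH hF hv0 hz.1.symm hy hz.2 X 1 hX
      rw [← h3, smul_add]
      simp only [canMap_smul_left, canMap_smul_right, Matrix.smul_mul, one_mul]
      abel
    have h4 := canInv_lim (hNmem hv).2 hr h1
    rw [canInv_left (hNmem hv).2] at h4
    refine h4.congr' ?_
    have hcd : Tendsto (fun z => canDet (r v z y₃)) (𝓝[≠] y) (𝓝 (canDet (r v y y₃))) :=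
      (canDet_continuous.tendsto _).comp hr
    filter_upwards [hcd.eventually_ne (hNmem hv).2] with z hz
    exact canInv_left hz _
  have hlim : ∀ Z : Mat n, Tendsto
      (fun z => canMap ((z - y) ^ k • prTensorPr (rc 0 y z) + 1) Z) (𝓝[≠] y)
      (𝓝 (c • prM Z + Z.trace • 1)) := by
    intro Z
    have h1 := (prM_continuous.tendsto _).comp (hK (prM Z) (prM_trace hn Z))
    rw [prM_smul, prM_of_trace (prM_trace hn Z)] at h1
    refine (h1.add_const (Z.trace • (1 : Mat n))).congr fun z => ?_
    rw [canMap_add_left, canMap_smul_left, canMap_one, canMap_prTensorPr]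
    simp only [Function.comp, prM_smul]
  obtain ⟨G0, hG0, hG1⟩ := tendsto_of_canMap hlim
  have hnC : (n : ℂ) ≠ 0 := by
    have : n ≠ 0 := by omega
    exact_mod_cast this
  have hdet0 : canDet G0 ≠ 0 := by
    refine canDet_ne_zero_of_injective fun Z hZ => ?_
    rw [hG1] at hZ
    have ht := congrArg Matrix.trace hZ
    rw [Matrix.trace_add, Matrix.trace_smul, prM_trace hn, Matrix.trace_smul, Matrix.trace_one,
      smul_zero, zero_add, Matrix.trace_zero, smul_eq_mul, Fintype.card_fin] at ht
    have ht0 : Z.trace = 0 := (mul_eq_zero.mp ht).resolve_right hnC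
    rw [ht0, zero_smul, add_zero, prM_of_trace ht0] at hZ
    exact (smul_eq_zero.mp hZ).resolve_left hc0
  have hcd : Tendsto (fun z => canDet ((z - y) ^ k • prTensorPr (rc 0 y z) + 1)) (𝓝[≠] y)
      (𝓝 (canDet G0)) := (canDet_continuous.tendsto _).comp hG0
  obtain ⟨z, hz1, hz2⟩ := ((hcd.eventually_ne hdet0).and
    (self_mem_nhdsWithin : ({y}ᶜ : Set ℂ) ∈ 𝓝[≠] y)).exists
  refine ⟨z, hz2, canDet_ne_zero_of_injective fun Z hZ => ?_⟩
  rw [canMap_add_left, canMap_one, canMap_prTensorPr] at hZ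
  have ht := congrArg Matrix.trace hZ
  rw [Matrix.trace_add, prM_trace hn, Matrix.trace_smul, Matrix.trace_one,
    zero_add, Matrix.trace_zero, smul_eq_mul, Fintype.card_fin] at ht
  have ht0 : Z.trace = 0 := (mul_eq_zero.mp ht).resolve_right hnC
  refine canMap_injective hz1 ?_
  rw [canMap_add_left, canMap_smul_left, canMap_one, canMap_prTensorPr]
  rw [ht0, zero_smul, add_zero] at hZ ⊢
  rw [hZ, smul_zero]

theorem bijOn_of_canDet {n : ℕ} (hn : 2 ≤ n) {t : T2 n} (h : canDet (prTensorPr t + 1) ≠ 0) :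
    Set.BijOn (canMap (prTensorPr t)) {Z : Mat n | Z.trace = 0} {Z : Mat n | Z.trace = 0} := by
  have hnC : (n : ℂ) ≠ 0 := by
    have : n ≠ 0 := by omega
    exact_mod_cast this
  have htr : ∀ Z, (canMap (prTensorPr t) Z).trace = 0 := by
    intro Z
    rw [canMap_prTensorPr]
    exact prM_trace hn _
  refine ⟨fun Z _ => htr Z, ?_, ?_⟩
  · intro Z hZ W hW hZW
    have hZ' : Z.trace = 0 := hZ
    have hW' : W.trace = 0 := hW
    rw [← sub_eq_zero]
    refine canMap_injective h ?_
    rw [canMap_add_left, canMap_one, canMap_sub_right, hZW, Matrix.trace_sub, hZ', hW']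
    simp
  · intro W hW
    have hW' : W.trace = 0 := hW
    have h1 := canInv_right h W
    rw [canMap_add_left, canMap_one] at h1
    have ht := congrArg Matrix.trace h1
    rw [Matrix.trace_add, htr, Matrix.trace_smul, Matrix.trace_one,
      zero_add, hW', smul_eq_mul, Fintype.card_fin] at ht
    have ht0 := (mul_eq_zero.mp ht).resolve_right hnC
    refine ⟨_, ht0, ?_⟩
    rw [ht0, zero_smul, add_zero] at h1
    exact h1

theorem prTensorPr_differentiableAt {n : ℕ} {f : ℂ → T2 n} {x : ℂ}
    (hf : DifferentiableAt ℂ f x) : DifferentiableAt ℂ (fun z => prTensorPr (f z)) x := by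
  let L : T2 n →ₗ[ℂ] T2 n :=
    { toFun := prTensorPr
      map_add' := fun s t => by
        rw [← sub_eq_zero]
        refine canMap_inj _ fun Z => ?_
        rw [canMap_sub_left, canMap_add_left]
        simp only [canMap_prTensorPr, canMap_add_left, prM_add, sub_self]
      map_smul' := fun a t => by
        rw [← sub_eq_zero]
        refine canMap_inj _ fun Z => ?_
        rw [canMap_sub_left, RingHom.id_apply, canMap_smul_left]
        simp only [canMap_prTensorPr, canMap_smul_left, prM_smul, sub_self] }
  exact (LinearMap.toContinuousLinearMap L).differentiableAt.comp x hf

theorem part_nondeg {n : ℕ} (hn : 2 ≤ n) {r : ℂ → ℂ → ℂ → T2 n} {rc : ℕ → ℂ → ℂ → T2 n}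
    (hA : IsAYBESolution r) (hU : IsUnitarySolution r) (hND : IsNonDegenerate r)
    (hH : IsHolomorphicOnDomain r) (hF : HasLaurentForm r rc)
    (hM : IsMeromorphicAlongDiagonal r) :
    IsNonDegenerateCYBE (fun y₁ y₂ => prTensorPr (rc 0 y₁ y₂)) := by
  rintro ⟨p₁, p₂⟩ hp
  rw [mem_closure_iff_nhds]
  intro V hV
  obtain ⟨V₁, hV₁, V₂, hV₂, hVV⟩ := mem_nhds_prod_iff.mp hV
  have h1 : ((1 : ℂ), p₁, p₂) ∈ closure {p : ℂ × ℂ × ℂ | p.1 ≠ 0 ∧ p.2.1 ≠ p.2.2 ∧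
      Function.Bijective (canMap (r p.1 p.2.1 p.2.2))} := hND ⟨one_ne_zero, hp⟩
  rw [mem_closure_iff_nhds] at h1
  obtain ⟨⟨w, y, y₃⟩, hy1, hw, hy, hbij⟩ := h1 (Set.univ ×ˢ V₁ ×ˢ Set.univ)
    (prod_mem_nhds univ_mem (prod_mem_nhds hV₁ univ_mem))
  have hyV : y ∈ V₁ := hy1.2.1
  change w ≠ 0 at hw
  change y ≠ y₃ at hy
  change Function.Bijective (canMap (r w y y₃)) at hbij
  have hdw : canDet (r w y y₃) ≠ 0 := by
    refine canDet_ne_zero_of_injective fun Z hZ => hbij.1 ?_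
    rw [hZ, canMap_zero_right]
  have hd : Dense {u : ℂ | u ≠ 0 ∧ canDet (r u y y₃) ≠ 0} :=
    dense_nonzero (f := fun u => canDet (r u y y₃))
      (fun u hu => canDet_differentiableAt (r_cont_v hH hu hy)) hw hdw
  obtain ⟨z₀, hz₀, hdz⟩ : ∃ z, z ≠ y ∧ canDet (prTensorPr (rc 0 y z) + 1) ≠ 0 := by
    by_cases hc : ∀ u, u ≠ 0 → ∃ c, Tendsto (fun z => r u y z) (𝓝[≠] y) (𝓝 c)
    · exact (no_caseB hn hA hU hH hF hy hd hc).elim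
    · push Not at hc
      obtain ⟨u₀, hu₀, hno⟩ := hc
      exact caseA hn hA hU hH hF hM hy hd hu₀ (by rintro ⟨c, hc⟩; exact hno c hc)
  have hd2 : Dense {z : ℂ | z ≠ y ∧ canDet (prTensorPr (rc 0 y z) + 1) ≠ 0} :=
    dense_nonzero (f := fun z => canDet (prTensorPr (rc 0 y z) + 1))
      (fun z hz => canDet_differentiableAt
        ((prTensorPr_differentiableAt (rc0_differentiableAt hH hF hz)).add_const 1)) hz₀ hdz
  obtain ⟨z, hzV, hzy, hz⟩ := (mem_closure_iff_nhds.mp (hd2 p₂)) V₂ hV₂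
  exact ⟨(y, z), hVV ⟨hyV, hzV⟩, hzy.symm, bijOn_of_canDet hn hz⟩

/-- For a non-degenerate unitary solution `r` of the AYBE, holomorphic on
`{v ≠ 0, y₁ ≠ y₂}`, of the form (*) and meromorphic along the diagonal,
`r̄₀ = (pr⊗pr)(r₀)` is a non-degenerate unitary solution of the CYBE. -/
theorem rbar_zero_nondeg_unitary_cybe (n : ℕ) (hn : 2 ≤ n)
    (r : ℂ → ℂ → ℂ → T2 n) (rc : ℕ → ℂ → ℂ → T2 n)
    (hAYBE : IsAYBESolution r) (hUnit : IsUnitarySolution r) (hND : IsNonDegenerate r)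
    (hHolo : IsHolomorphicOnDomain r) (hForm : HasLaurentForm r rc)
    (hMero : IsMeromorphicAlongDiagonal r) :
    IsCYBESolution (fun y₁ y₂ => prTensorPr (rc 0 y₁ y₂)) ∧
      IsUnitaryCYBE (fun y₁ y₂ => prTensorPr (rc 0 y₁ y₂)) ∧
      IsNonDegenerateCYBE (fun y₁ y₂ => prTensorPr (rc 0 y₁ y₂)) := by
  exact ⟨part_cybe hn hAYBE hUnit hHolo hForm, part_unitary hUnit hForm,
    part_nondeg hn hAYBE hUnit hND hHolo hForm hMero⟩
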